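/- (Weighted Young inequality, Stein–Weiss type.) Let 1 < q ≤ r < ∞ and a, b, c ∈ ℝ satisfy 1/r = 1/q − 1 + (a+b+c)/d, b + c ≥ 0, 0 < a < d, b < d(1 − 1/q), and c < d/r. Then there is a constant C such that for all measurable f, g : ℝ^d → ℝ, ‖ x ↦ (f*g)(x) |x|^{−c} ‖_{L^r(ℝ^d)} ≤ C ‖ x ↦ f(x)|x|^{a} ‖_{L^∞(ℝ^d)} · ‖ x ↦ g(x)|x|^{b} ‖_{L^q(ℝ^d)}. -/

import Mathlib

open MeasureTheory ENNReal NNReal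

noncomputable section
set_option linter.unusedSectionVars false
set_option linter.unusedSimpArgs false
section SW

variable {E : Type*} [NormedAddCommGroup E] [InnerProductSpace ℝ E] [FiniteDimensional ℝ E]
  [MeasurableSpace E] [BorelSpace E] [Nontrivial E]

lemma sw_scale (F : E → ℝ≥0∞) (hF : Measurable F) (R : ℝ) (hR : 0 < R) :
    ∫⁻ y : E, F y = ENNReal.ofReal R ^ (Module.finrank ℝ E : ℝ) * ∫⁻ y : E, F (R • y) := by
  have h := Measure.map_addHaar_smul (volume : Measure E) hR.ne'
  have h2 : ∫⁻ y : E, F (R • y) = ∫⁻ y, F y ∂(Measure.map (fun y : E => R • y) volume) := by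
    rw [lintegral_map hF (by fun_prop)]
  have h3 : Measure.map (fun y : E => R • y) volume = Measure.map (R • ·) (volume : Measure E) := rfl
  rw [h2, h3, h, lintegral_smul_measure, smul_eq_mul, ← mul_assoc]
  rw [abs_of_pos (by positivity), ENNReal.rpow_natCast, ← ENNReal.ofReal_pow hR.le,
    ← ENNReal.ofReal_mul (by positivity), mul_inv_cancel₀ (by positivity)]
  simp

lemma sw_enorm_rpow (y : E) (hy : y ≠ 0) (s : ℝ) : ‖y‖ₑ ^ s = ENNReal.ofReal (‖y‖ ^ s) := by
  rw [← ENNReal.ofReal_rpow_of_pos (norm_pos_iff.2 hy), ofReal_norm]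

lemma sw_ae_ne (x : E) : ∀ᵐ y : E, y ≠ x := by
  simp [ae_iff]

lemma sw_ball_one (s : ℝ) (hs : s < Module.finrank ℝ E) :
    ∫⁻ y : E, (if ‖y‖ₑ ≤ 1 then ‖y‖ₑ ^ (-s) else 0) ≠ ⊤ := by
  let f : ℝ → ℝ := (Set.Iic 1).indicator (fun t => t ^ (-s))
  have hi : Integrable (fun y : E => f ‖y‖) volume := by
    rw [integrable_fun_norm_addHaar]
    have : IntegrableOn (fun t : ℝ => t ^ ((Module.finrank ℝ E : ℝ) - 1 - s)) (Set.Ioc 0 1) := by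
      rw [← intervalIntegrable_iff_integrableOn_Ioc_of_le zero_le_one]
      exact intervalIntegral.intervalIntegrable_rpow' (by linarith)
    rw [← integrable_indicator_iff measurableSet_Ioi]
    rw [← integrable_indicator_iff measurableSet_Ioc] at this
    refine this.congr (Filter.Eventually.of_forall fun t => ?_)
    by_cases ht : 0 < t
    · by_cases ht1 : t ≤ 1
      · simp only [f, Set.indicator, Set.mem_Ioc, Set.mem_Ioi, Set.mem_Iic, ht, ht1, and_self, if_true]
        rw [smul_eq_mul, ← Real.rpow_natCast, ← Real.rpow_add ht]
        congr 1
        have : 1 ≤ Module.finrank ℝ E := Module.finrank_pos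
        push_cast [this]; ring
      · simp [f, Set.indicator, ht, ht1]
    · simp [f, Set.indicator, ht]
  have := hi.lintegral_lt_top
  refine ne_of_lt (lt_of_le_of_lt (le_of_eq ?_) this)
  refine lintegral_congr_ae ?_
  filter_upwards [sw_ae_ne (0 : E)] with y hy
  have : ‖y‖ₑ ≤ 1 ↔ ‖y‖ ≤ 1 := by
    rw [← ofReal_norm, ENNReal.ofReal_le_one]
  by_cases h : ‖y‖ ≤ 1
  · simp only [this, h, f, Set.indicator, Set.mem_Iic, if_true]
    exact sw_enorm_rpow y hy _
  · simp [this, h, f, Set.indicator]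

lemma sw_out_one (s : ℝ) (hs : Module.finrank ℝ E < s) :
    ∫⁻ y : E, (if 1 ≤ ‖y‖ₑ then ‖y‖ₑ ^ (-s) else 0) ≠ ⊤ := by
  let f : ℝ → ℝ := (Set.Ici 1).indicator (fun t => t ^ (-s))
  have hi : Integrable (fun y : E => f ‖y‖) volume := by
    rw [integrable_fun_norm_addHaar]
    have : IntegrableOn (fun t : ℝ => t ^ ((Module.finrank ℝ E : ℝ) - 1 - s)) (Set.Ici 1) := by
      rw [integrableOn_Ici_iff_integrableOn_Ioi]
      exact integrableOn_Ioi_rpow_of_lt (by linarith) one_pos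
    rw [← integrable_indicator_iff measurableSet_Ioi]
    rw [← integrable_indicator_iff measurableSet_Ici] at this
    refine this.congr (Filter.Eventually.of_forall fun t => ?_)
    by_cases ht1 : 1 ≤ t
    · have ht : 0 < t := by linarith
      simp only [f, Set.indicator, Set.mem_Ici, Set.mem_Ioi, ht, ht1, if_true]
      rw [smul_eq_mul, ← Real.rpow_natCast, ← Real.rpow_add ht]
      congr 1
      have : 1 ≤ Module.finrank ℝ E := Module.finrank_pos
      push_cast [this]; ring
    · simp [f, Set.indicator, ht1]
  have := hi.lintegral_lt_top
  refine ne_of_lt (lt_of_le_of_lt (le_of_eq ?_) this)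
  refine lintegral_congr_ae ?_
  filter_upwards [sw_ae_ne (0 : E)] with y hy
  have : 1 ≤ ‖y‖ₑ ↔ 1 ≤ ‖y‖ := by
    rw [← ofReal_norm, ENNReal.one_le_ofReal]
  by_cases h : 1 ≤ ‖y‖
  · simp only [this, h, f, Set.indicator, Set.mem_Ici, if_true]
    exact sw_enorm_rpow y hy _
  · simp [this, h, f, Set.indicator]

lemma sw_enorm_smul (R : ℝ) (hR : 0 < R) (y : E) : ‖R • y‖ₑ = ENNReal.ofReal R * ‖y‖ₑ := by
  rw [enorm_smul, Real.enorm_eq_ofReal hR.le]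

lemma sw_ball (D s : ℝ) (hD : (Module.finrank ℝ E : ℝ) = D) (hs : s < D) :
    ∃ C : ℝ≥0∞, C ≠ ⊤ ∧ 1 ≤ C ∧ ∀ R : ℝ≥0∞, R ≠ 0 → R ≠ ⊤ →
      ∫⁻ y : E, (if ‖y‖ₑ ≤ R then ‖y‖ₑ ^ (-s) else 0) ≤ C * R ^ (D - s) := by
  refine ⟨(∫⁻ y : E, (if ‖y‖ₑ ≤ 1 then ‖y‖ₑ ^ (-s) else 0)) + 1, ?_, le_add_self, ?_⟩
  · exact ENNReal.add_ne_top.2 ⟨sw_ball_one s (hD ▸ hs), one_ne_top⟩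
  intro R hR0 hRt
  have hR : 0 < R.toReal := ENNReal.toReal_pos hR0 hRt
  have hm : Measurable (fun y : E => if ‖y‖ₑ ≤ R then ‖y‖ₑ ^ (-s) else 0) :=
    Measurable.ite (measurableSet_le (by fun_prop) (by fun_prop)) (by fun_prop) (by fun_prop)
  rw [sw_scale _ hm _ hR, ENNReal.ofReal_toReal hRt, hD]
  have : ∀ᵐ y : E, (if ‖R.toReal • y‖ₑ ≤ R then ‖R.toReal • y‖ₑ ^ (-s) else 0)
      = R ^ (-s) * (if ‖y‖ₑ ≤ 1 then ‖y‖ₑ ^ (-s) else 0) := by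
    filter_upwards with y
    rw [sw_enorm_smul _ hR, ENNReal.ofReal_toReal hRt,
      ENNReal.mul_rpow_of_ne_top hRt enorm_ne_top]
    have : R * ‖y‖ₑ ≤ R ↔ ‖y‖ₑ ≤ 1 := by
      conv_lhs => rw [← mul_one R, mul_assoc, one_mul]
      exact ENNReal.mul_le_mul_iff_right hR0 hRt
    simp [this]
  rw [lintegral_congr_ae this, lintegral_const_mul' _ _ (ENNReal.rpow_ne_top_of_ne_zero hR0 hRt),
    ← mul_assoc, ← ENNReal.rpow_add _ _ hR0 hRt, mul_comm, sub_eq_add_neg]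
  gcongr
  exact le_self_add

lemma sw_out (D s : ℝ) (hD : (Module.finrank ℝ E : ℝ) = D) (hs : D < s) :
    ∃ C : ℝ≥0∞, C ≠ ⊤ ∧ 1 ≤ C ∧ ∀ R : ℝ≥0∞, R ≠ 0 → R ≠ ⊤ →
      ∫⁻ y : E, (if R ≤ ‖y‖ₑ then ‖y‖ₑ ^ (-s) else 0) ≤ C * R ^ (D - s) := by
  refine ⟨(∫⁻ y : E, (if 1 ≤ ‖y‖ₑ then ‖y‖ₑ ^ (-s) else 0)) + 1, ?_, le_add_self, ?_⟩
  · exact ENNReal.add_ne_top.2 ⟨sw_out_one s (hD ▸ hs), one_ne_top⟩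
  intro R hR0 hRt
  have hR : 0 < R.toReal := ENNReal.toReal_pos hR0 hRt
  have hm : Measurable (fun y : E => if R ≤ ‖y‖ₑ then ‖y‖ₑ ^ (-s) else 0) :=
    Measurable.ite (measurableSet_le (by fun_prop) (by fun_prop)) (by fun_prop) (by fun_prop)
  rw [sw_scale _ hm _ hR, ENNReal.ofReal_toReal hRt, hD]
  have : ∀ᵐ y : E, (if R ≤ ‖R.toReal • y‖ₑ then ‖R.toReal • y‖ₑ ^ (-s) else 0)
      = R ^ (-s) * (if 1 ≤ ‖y‖ₑ then ‖y‖ₑ ^ (-s) else 0) := by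
    filter_upwards with y
    rw [sw_enorm_smul _ hR, ENNReal.ofReal_toReal hRt,
      ENNReal.mul_rpow_of_ne_top hRt enorm_ne_top]
    have : R ≤ R * ‖y‖ₑ ↔ 1 ≤ ‖y‖ₑ := by
      conv_lhs => rw [← mul_one R, mul_assoc, one_mul]
      exact ENNReal.mul_le_mul_iff_right hR0 hRt
    simp [this]
  rw [lintegral_congr_ae this, lintegral_const_mul' _ _ (ENNReal.rpow_ne_top_of_ne_zero hR0 hRt),
    ← mul_assoc, ← ENNReal.rpow_add _ _ hR0 hRt, mul_comm, sub_eq_add_neg]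
  gcongr
  exact le_self_add

lemma sw_layer_eq (k : ℝ) (hk : 0 < k) (v : ℝ≥0∞) (hv : v ≠ ⊤) :
    ∫⁻ t in Set.Ioi (0 : ℝ),
      ENNReal.ofReal t ^ (k - 1) * (if ENNReal.ofReal t < v then 1 else 0) =
      ENNReal.ofReal k⁻¹ * v ^ k := by
  lift v to ℝ≥0 using hv
  have h1 : ∫⁻ t in Set.Ioi (0 : ℝ),
      ENNReal.ofReal t ^ (k - 1) * (if ENNReal.ofReal t < v then 1 else 0) =
      ∫⁻ t in Set.Ioo (0 : ℝ) v, ENNReal.ofReal (t ^ (k - 1)) := by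
    rw [← lintegral_indicator measurableSet_Ioi, ← lintegral_indicator measurableSet_Ioo]
    refine lintegral_congr fun t => ?_
    by_cases ht : 0 < t
    · have : ENNReal.ofReal t < v ↔ t < v := by
        rw [← ENNReal.ofReal_coe_nnreal, ENNReal.ofReal_lt_ofReal_iff_of_nonneg ht.le]
      by_cases htv : t < v
      · simp [Set.indicator, ht, this, htv, ENNReal.ofReal_rpow_of_pos ht]
      · simp [Set.indicator, ht, this, htv]
    · simp [Set.indicator, ht]
  rw [h1, setLIntegral_congr Ioo_ae_eq_Ioc, ← ofReal_integral_eq_lintegral_ofReal]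
  · rw [← intervalIntegral.integral_of_le (NNReal.coe_nonneg v), integral_rpow (Or.inl (by linarith)),
      ← ENNReal.ofReal_coe_nnreal, ENNReal.ofReal_rpow_of_nonneg (NNReal.coe_nonneg v) hk.le,
      ← ENNReal.ofReal_mul (by positivity)]
    congr 1
    rw [sub_add_cancel, Real.zero_rpow hk.ne']
    field_simp
    simp
  · have := (intervalIntegral.intervalIntegrable_rpow' (a := 0) (b := (v : ℝ)) (r := k - 1)
      (by linarith))
    exact (intervalIntegrable_iff_integrableOn_Ioc_of_le (NNReal.coe_nonneg v)).1 this
  · filter_upwards [ae_restrict_mem measurableSet_Ioc] with t ht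
    exact Real.rpow_nonneg ht.1.le _

lemma sw_layer_le (r : ℝ) (hr : 0 < r) (u : ℝ≥0∞) :
    u ^ r ≤ ENNReal.ofReal r * ∫⁻ t in Set.Ioi (0 : ℝ),
      ENNReal.ofReal t ^ (r - 1) * (if ENNReal.ofReal t < u then 1 else 0) := by
  have key : ∀ N : ℝ≥0∞, N ≠ ⊤ → N ≤ u → N ^ r ≤ ENNReal.ofReal r * ∫⁻ t in Set.Ioi (0 : ℝ),
      ENNReal.ofReal t ^ (r - 1) * (if ENNReal.ofReal t < u then 1 else 0) := by
    intro N hN hNu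
    have h := sw_layer_eq r hr N hN
    have h2 : N ^ r = ENNReal.ofReal r * (ENNReal.ofReal r⁻¹ * N ^ r) := by
      rw [← mul_assoc, ← ENNReal.ofReal_mul hr.le, mul_inv_cancel₀ hr.ne']; simp
    rw [h2, ← h]
    gcongr with t
    split_ifs with h3 h4
    · exact le_rfl
    · exact absurd (h3.trans_le hNu) h4
    · exact zero_le_one
    · exact le_rfl
  by_cases hu : u = ⊤
  · refine (ENNReal.le_rpow_inv_iff hr).1 ?_
    refine ENNReal.le_of_forall_nnreal_lt fun N hN => ?_
    exact (ENNReal.le_rpow_inv_iff hr).2 (key N ENNReal.coe_ne_top hN.le)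
  · exact key u hu le_rfl

lemma sw_layer_ge (k : ℝ) (hk : 0 < k) (v : ℝ≥0∞) :
    ∫⁻ t in Set.Ioi (0 : ℝ),
      ENNReal.ofReal t ^ (k - 1) * (if ENNReal.ofReal t < v then 1 else 0) ≤
      ENNReal.ofReal k⁻¹ * v ^ k := by
  by_cases hv : v = ⊤
  · rw [hv, ENNReal.top_rpow_of_pos hk, ENNReal.mul_top (by simpa using hk)]
    exact le_top
  · exact (sw_layer_eq k hk v hv).le

lemma sw_rpow_neg_ne_top (x : E) (hx : x ≠ 0) (s : ℝ) : ‖x‖ₑ ^ s ≠ ⊤ :=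
  ENNReal.rpow_ne_top_of_ne_zero (enorm_ne_zero.2 hx) enorm_ne_top

lemma sw_rpow_add (x : E) (hx : x ≠ 0) (s t : ℝ) : ‖x‖ₑ ^ s * ‖x‖ₑ ^ t = ‖x‖ₑ ^ (s + t) :=
  (ENNReal.rpow_add s t (enorm_ne_zero.2 hx) enorm_ne_top).symm

lemma sw_schur (q q' α : ℝ) (hq : q.HolderConjugate q') (K : E → E → ℝ≥0∞)
    (hK : Measurable (Function.uncurry K)) (A B : ℝ≥0∞)
    (H1 : ∀ x : E, x ≠ 0 → ∫⁻ y, K x y * ‖y‖ₑ ^ (-(α * q')) ≤ A * ‖x‖ₑ ^ (-(α * q')))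
    (H2 : ∀ y : E, y ≠ 0 → ∫⁻ x, K x y * ‖x‖ₑ ^ (-(α * q)) ≤ B * ‖y‖ₑ ^ (-(α * q)))
    (h : E → ℝ≥0∞) (hh : Measurable h) :
    ∫⁻ x, (∫⁻ y, K x y * h y) ^ q ≤ A ^ (q / q') * B * ∫⁻ y, h y ^ q := by
  have hq0 : 0 < q := hq.pos
  have hq0' : 0 < q' := hq.symm.pos
  have hsum : 1 / q' + 1 / q = 1 := by
    have := hq.inv_add_inv_eq_one
    simp only [one_div]; linarith
  have hKx : ∀ x, Measurable (K x) := fun x => hK.of_uncurry_left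
  have hKy : ∀ y, Measurable (fun x => K x y) := fun y => hK.of_uncurry_right
  have step1 : ∀ x : E, x ≠ 0 → (∫⁻ y, K x y * h y) ^ q ≤
      A ^ (q / q') * (‖x‖ₑ ^ (-(α * q)) * ∫⁻ y, K x y * (‖y‖ₑ ^ (α * q) * h y ^ q)) := by
    intro x hx
    have e1 : ∫⁻ y, K x y * h y = ∫⁻ y, ((fun y => K x y ^ (1 / q') * ‖y‖ₑ ^ (-α)) *
        (fun y => K x y ^ (1 / q) * (‖y‖ₑ ^ α * h y))) y := by
      refine lintegral_congr_ae ?_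
      filter_upwards [sw_ae_ne (0 : E)] with y hy
      have h1 : K x y = K x y ^ (1 / q') * K x y ^ (1 / q) := by
        rw [← ENNReal.rpow_add_of_nonneg _ _ (by positivity) (by positivity), hsum,
          ENNReal.rpow_one]
      have h2 : ‖y‖ₑ ^ (-α) * ‖y‖ₑ ^ α = 1 := by
        rw [sw_rpow_add y hy]; simp
      simp only [Pi.mul_apply]
      calc K x y * h y = (K x y ^ (1 / q') * K x y ^ (1 / q)) * 1 * h y := by rw [← h1, mul_one]
        _ = _ := by rw [← h2]; ring
    have hol := ENNReal.lintegral_mul_le_Lp_mul_Lq (volume : Measure E) hq.symm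
      (f := fun y => K x y ^ (1 / q') * ‖y‖ₑ ^ (-α))
      (g := fun y => K x y ^ (1 / q) * (‖y‖ₑ ^ α * h y))
      (((hKx x).pow_const _).mul (by fun_prop)).aemeasurable
      (((hKx x).pow_const _).mul (by fun_prop)).aemeasurable
    rw [← e1] at hol
    have e2 : ∀ y, (K x y ^ (1 / q') * ‖y‖ₑ ^ (-α)) ^ q' = K x y * ‖y‖ₑ ^ (-(α * q')) := by
      intro y
      rw [ENNReal.mul_rpow_of_nonneg _ _ hq0'.le, ← ENNReal.rpow_mul, ← ENNReal.rpow_mul]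
      congr 1
      · rw [one_div, inv_mul_cancel₀ hq0'.ne', ENNReal.rpow_one]
      · congr 1; ring
    have e3 : ∀ y, (K x y ^ (1 / q) * (‖y‖ₑ ^ α * h y)) ^ q
        = K x y * (‖y‖ₑ ^ (α * q) * h y ^ q) := by
      intro y
      rw [ENNReal.mul_rpow_of_nonneg _ _ hq0.le, ENNReal.mul_rpow_of_nonneg _ _ hq0.le,
        ← ENNReal.rpow_mul, ← ENNReal.rpow_mul]
      congr 1
      · rw [one_div, inv_mul_cancel₀ hq0.ne', ENNReal.rpow_one]
    simp only [e2, e3] at hol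
    calc (∫⁻ y, K x y * h y) ^ q
        ≤ ((A * ‖x‖ₑ ^ (-(α * q'))) ^ (1 / q') *
          (∫⁻ y, K x y * (‖y‖ₑ ^ (α * q) * h y ^ q)) ^ (1 / q)) ^ q := by
          gcongr
          refine hol.trans ?_
          gcongr
          exact H1 x hx
      _ = _ := by
          rw [ENNReal.mul_rpow_of_nonneg _ _ hq0.le, ← ENNReal.rpow_mul, ← ENNReal.rpow_mul,
            one_div_mul_cancel hq0.ne', ENNReal.rpow_one,
            ENNReal.mul_rpow_of_nonneg _ _ (by positivity), ← ENNReal.rpow_mul, mul_assoc]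
          congr 2
          · ring
          · congr 1; field_simp
  calc ∫⁻ x, (∫⁻ y, K x y * h y) ^ q
      ≤ ∫⁻ x, A ^ (q / q') * (‖x‖ₑ ^ (-(α * q)) * ∫⁻ y, K x y * (‖y‖ₑ ^ (α * q) * h y ^ q)) := by
        refine lintegral_mono_ae ?_
        filter_upwards [sw_ae_ne (0 : E)] with x hx using step1 x hx
    _ = A ^ (q / q') * ∫⁻ x, ∫⁻ y, ‖x‖ₑ ^ (-(α * q)) * (K x y * (‖y‖ₑ ^ (α * q) * h y ^ q)) := by
        rw [lintegral_const_mul]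
        · congr 1
          refine lintegral_congr fun x => ?_
          rw [lintegral_const_mul]
          exact (hKx x).mul (by fun_prop)
        · refine Measurable.mul (by fun_prop) ?_
          refine Measurable.lintegral_prod_right' (f := fun p : E × E =>
            K p.1 p.2 * (‖p.2‖ₑ ^ (α * q) * h p.2 ^ q)) ?_
          exact hK.mul (by fun_prop)
    _ = A ^ (q / q') * ∫⁻ y, ∫⁻ x, ‖x‖ₑ ^ (-(α * q)) * (K x y * (‖y‖ₑ ^ (α * q) * h y ^ q)) := by
        rw [lintegral_lintegral_swap]
        refine Measurable.aemeasurable ?_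
        refine Measurable.mul (f := fun p : E × E => ‖p.1‖ₑ ^ (-(α * q)))
          (g := fun p : E × E => K p.1 p.2 * (‖p.2‖ₑ ^ (α * q) * h p.2 ^ q)) (by fun_prop) ?_
        exact hK.mul (by fun_prop)
    _ ≤ A ^ (q / q') * ∫⁻ y, B * h y ^ q := by
        refine mul_le_mul_right (lintegral_mono_ae ?_) _
        filter_upwards [sw_ae_ne (0 : E)] with y hy
        calc ∫⁻ x, ‖x‖ₑ ^ (-(α * q)) * (K x y * (‖y‖ₑ ^ (α * q) * h y ^ q))
            = ∫⁻ x, (K x y * ‖x‖ₑ ^ (-(α * q))) * (‖y‖ₑ ^ (α * q) * h y ^ q) := by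
              refine lintegral_congr fun x => ?_
              ring
          _ = (∫⁻ x, (K x y * ‖x‖ₑ ^ (-(α * q)))) * (‖y‖ₑ ^ (α * q) * h y ^ q) := by
              rw [lintegral_mul_const]
              exact (hKy y).mul (by fun_prop)
          _ ≤ (B * ‖y‖ₑ ^ (-(α * q))) * (‖y‖ₑ ^ (α * q) * h y ^ q) := by
              gcongr
              exact H2 y hy
          _ = B * (‖y‖ₑ ^ (-(α * q)) * ‖y‖ₑ ^ (α * q)) * h y ^ q := by ring
          _ = B * h y ^ q := by rw [sw_rpow_add y hy]; simp
    _ = _ := by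
        rw [lintegral_const_mul _ (by fun_prop), mul_assoc]

/-- Hölder in normalized form. -/
lemma sw_holder (q q' : ℝ) (hq : q.HolderConjugate q') (k h : E → ℝ≥0∞) (hk : Measurable k)
    (hh : Measurable h) (h1 : ∫⁻ y, h y ^ q ≤ 1) :
    ∫⁻ y, k y * h y ≤ (∫⁻ y, k y ^ q') ^ (1 / q') := by
  have hol := ENNReal.lintegral_mul_le_Lp_mul_Lq (volume : Measure E) hq.symm
    hk.aemeasurable hh.aemeasurable
  refine hol.trans ?_
  calc _ ≤ (∫⁻ y, k y ^ q') ^ (1 / q') * 1 := by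
        gcongr
        exact ENNReal.rpow_le_one h1 (by have := hq.pos; positivity)
    _ = _ := mul_one _

lemma sw_hardy (D q q' r γ β α : ℝ) (hq : q.HolderConjugate q') (hqr : q ≤ r)
    (hγ : γ + β = D / q' + D / r) (χ : E → E → ℝ≥0∞) (hχ : Measurable (Function.uncurry χ))
    (hχ1 : ∀ x y, χ x y ≤ 1) (A : ℝ≥0∞)
    (H0 : ∀ x : E, x ≠ 0 → ∫⁻ y, χ x y * ‖y‖ₑ ^ (-(β * q')) ≤ A * ‖x‖ₑ ^ (D - β * q'))
    (H1 : ∀ x : E, x ≠ 0 →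
      ∫⁻ y, χ x y * ‖y‖ₑ ^ (-(β + α * q')) ≤ A * ‖x‖ₑ ^ (D - (β + α * q')))
    (H2 : ∀ y : E, y ≠ 0 →
      ∫⁻ x, χ x y * ‖x‖ₑ ^ (-(D - β + α * q)) ≤ A * ‖y‖ₑ ^ (β - α * q))
    (h : E → ℝ≥0∞) (hh : Measurable h) (hn : ∫⁻ y, h y ^ q ≤ 1) :
    ∫⁻ x, (∫⁻ y, (χ x y * ‖x‖ₑ ^ (-γ) * ‖y‖ₑ ^ (-β)) * h y) ^ r ≤
      A ^ ((r - q) / q') * (A ^ (q / q') * A) := by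
  have hq0 : 0 < q := hq.pos
  have hr0 : 0 < r := hq0.trans_le hqr
  have hq0' : 0 < q' := hq.symm.pos
  have hq1' : 1 ≤ q' := hq.symm.lt.le
  have hsum : 1 / q + 1 / q' = 1 := by
    have := hq.inv_add_inv_eq_one
    simp only [one_div]; linarith
  have hχx : ∀ x, Measurable (χ x) := fun x => hχ.of_uncurry_left
  have hχy : ∀ y, Measurable (fun x => χ x y) := fun y => hχ.of_uncurry_right
  let F : E → ℝ≥0∞ := fun x => ∫⁻ y, (χ x y * ‖y‖ₑ ^ (-β)) * h y
  have hF : ∀ (s : ℝ) (x : E), ∫⁻ y, (χ x y * ‖x‖ₑ ^ s * ‖y‖ₑ ^ (-β)) * h y = ‖x‖ₑ ^ s * F x := by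
    intro s x
    rw [← lintegral_const_mul]
    · refine lintegral_congr fun y => ?_
      ring
    · exact ((hχx x).mul (by fun_prop)).mul hh
  have hFb : ∀ x : E, x ≠ 0 → F x ≤ A ^ (1 / q') * ‖x‖ₑ ^ (D / q' - β) := by
    intro x hx
    refine (sw_holder q q' hq (fun y => χ x y * ‖y‖ₑ ^ (-β)) h
      ((hχx x).mul (by fun_prop)) hh hn).trans ?_
    calc (∫⁻ y, (χ x y * ‖y‖ₑ ^ (-β)) ^ q') ^ (1 / q')
        ≤ (∫⁻ y, χ x y * ‖y‖ₑ ^ (-(β * q'))) ^ (1 / q') := by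
          gcongr with y
          rw [ENNReal.mul_rpow_of_nonneg _ _ hq0'.le, ← ENNReal.rpow_mul, neg_mul]
          gcongr
          exact ENNReal.rpow_le_self_of_le_one (hχ1 x y) hq1'
      _ ≤ (A * ‖x‖ₑ ^ (D - β * q')) ^ (1 / q') := by
          gcongr
          exact H0 x hx
      _ = _ := by
          rw [ENNReal.mul_rpow_of_nonneg _ _ (by positivity), ← ENNReal.rpow_mul]
          congr 2
          field_simp
  have hpt : ∀ x : E, x ≠ 0 → (∫⁻ y, (χ x y * ‖x‖ₑ ^ (-γ) * ‖y‖ₑ ^ (-β)) * h y) ^ r ≤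
      A ^ ((r - q) / q') * (∫⁻ y, (χ x y * ‖x‖ₑ ^ (β - D) * ‖y‖ₑ ^ (-β)) * h y) ^ q := by
    intro x hx
    rw [hF, hF]
    have hexp : (D / q' - β - γ) * (r - q) + (-γ) * q = (β - D) * q := by
      have h3 : D / q' - β - γ = - (D / r) := by linarith
      have h4 : γ = D / q' + D / r - β := by linarith
      have h5 : 1 / q' = 1 - 1 / q := by linarith
      have h6 : D / q' = D - D / q := by
        rw [div_eq_mul_one_div, h5]; ring
      rw [h3, h4, h6]
      field_simp
      ring
    calc (‖x‖ₑ ^ (-γ) * F x) ^ r = (‖x‖ₑ ^ (-γ) * F x) ^ (r - q) * (‖x‖ₑ ^ (-γ) * F x) ^ q := by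
          rw [← ENNReal.rpow_add_of_nonneg _ _ (by linarith) hq0.le, sub_add_cancel]
      _ ≤ (‖x‖ₑ ^ (-γ) * (A ^ (1 / q') * ‖x‖ₑ ^ (D / q' - β))) ^ (r - q)
            * (‖x‖ₑ ^ (-γ) * F x) ^ q := by
          gcongr
          exact hFb x hx
      _ = (A ^ (1 / q') * ‖x‖ₑ ^ (D / q' - β - γ)) ^ (r - q)
            * (‖x‖ₑ ^ (-γ) * F x) ^ q := by
          congr 2
          rw [mul_left_comm, sw_rpow_add x hx]
          congr 2; ring
      _ = A ^ ((r - q) / q') * (‖x‖ₑ ^ ((D / q' - β - γ) * (r - q)) * ‖x‖ₑ ^ ((-γ) * q))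
            * F x ^ q := by
          rw [ENNReal.mul_rpow_of_nonneg _ _ (by linarith), ENNReal.mul_rpow_of_nonneg _ _ hq0.le,
            ← ENNReal.rpow_mul, ← ENNReal.rpow_mul, ← ENNReal.rpow_mul,
            show 1 / q' * (r - q) = (r - q) / q' by ring]
          ring
      _ = _ := by
          rw [sw_rpow_add x hx, hexp, ENNReal.mul_rpow_of_nonneg _ _ hq0.le, ← ENNReal.rpow_mul,
            mul_assoc]
  have hKm : Measurable (Function.uncurry fun x y : E => χ x y * ‖x‖ₑ ^ (β - D) * ‖y‖ₑ ^ (-β)) :=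
    (hχ.mul (by fun_prop)).mul (by fun_prop)
  have hS := sw_schur q q' α hq (fun x y => χ x y * ‖x‖ₑ ^ (β - D) * ‖y‖ₑ ^ (-β)) hKm A A
    (by
      intro x hx
      calc ∫⁻ y, χ x y * ‖x‖ₑ ^ (β - D) * ‖y‖ₑ ^ (-β) * ‖y‖ₑ ^ (-(α * q'))
          = ∫⁻ y, ‖x‖ₑ ^ (β - D) * (χ x y * ‖y‖ₑ ^ (-(β + α * q'))) := by
            refine lintegral_congr_ae ?_
            filter_upwards [sw_ae_ne (0 : E)] with y hy
            rw [mul_assoc, sw_rpow_add y hy, neg_add]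
            ring
        _ = ‖x‖ₑ ^ (β - D) * ∫⁻ y, (χ x y * ‖y‖ₑ ^ (-(β + α * q'))) :=
            lintegral_const_mul _ ((hχx x).mul (by fun_prop))
        _ ≤ ‖x‖ₑ ^ (β - D) * (A * ‖x‖ₑ ^ (D - (β + α * q'))) := by
            gcongr
            exact H1 x hx
        _ = _ := by
            rw [mul_left_comm, sw_rpow_add x hx]
            congr 2; ring)
    (by
      intro y hy
      calc ∫⁻ x, χ x y * ‖x‖ₑ ^ (β - D) * ‖y‖ₑ ^ (-β) * ‖x‖ₑ ^ (-(α * q))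
          = ∫⁻ x, ‖y‖ₑ ^ (-β) * (χ x y * ‖x‖ₑ ^ (-(D - β + α * q))) := by
            refine lintegral_congr_ae ?_
            filter_upwards [sw_ae_ne (0 : E)] with x hx
            rw [show -(D - β + α * q) = (β - D) + (-(α * q)) by ring, ← sw_rpow_add x hx]
            ring
        _ = ‖y‖ₑ ^ (-β) * ∫⁻ x, (χ x y * ‖x‖ₑ ^ (-(D - β + α * q))) :=
            lintegral_const_mul _ ((hχy y).mul (by fun_prop))
        _ ≤ ‖y‖ₑ ^ (-β) * (A * ‖y‖ₑ ^ (β - α * q)) := by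
            gcongr
            exact H2 y hy
        _ = _ := by
            rw [mul_left_comm, sw_rpow_add y hy]
            congr 2; ring) h hh
  calc _ ≤ ∫⁻ x, A ^ ((r - q) / q') *
          (∫⁻ y, (χ x y * ‖x‖ₑ ^ (β - D) * ‖y‖ₑ ^ (-β)) * h y) ^ q := by
        refine lintegral_mono_ae ?_
        filter_upwards [sw_ae_ne (0 : E)] with x hx using hpt x hx
    _ = A ^ ((r - q) / q') *
          ∫⁻ x, (∫⁻ y, (χ x y * ‖x‖ₑ ^ (β - D) * ‖y‖ₑ ^ (-β)) * h y) ^ q := by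
        rw [lintegral_const_mul]
        refine Measurable.pow_const ?_ _
        refine Measurable.lintegral_prod_right' (f := fun p : E × E =>
            χ p.1 p.2 * ‖p.1‖ₑ ^ (β - D) * ‖p.2‖ₑ ^ (-β) * h p.2) ?_
        exact hKm.mul (by fun_prop)
    _ ≤ _ := by
        gcongr
        refine hS.trans ?_
        calc _ ≤ A ^ (q / q') * A * 1 := by gcongr
          _ = _ := mul_one _

lemma sw_weak (D l q q' r : ℝ) (hD : (Module.finrank ℝ E : ℝ) = D) (hq : q.HolderConjugate q')
    (hqr : q < r) (hl : l = D / q' + D / r) :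
    ∃ G : ℝ≥0∞, G ≠ ⊤ ∧ ∀ h : E → ℝ≥0∞, Measurable h → ∫⁻ y, h y ^ q ≤ 1 →
      ∀ τ : ℝ≥0∞, τ ≠ 0 → τ ≠ ⊤ →
      volume {x : E | τ < ∫⁻ y, ‖x - y‖ₑ ^ (-l) * h y} ≤
        G * τ ^ (-(r / q)) * ∫⁻ y, (if τ < (G * h y) ^ (q / r) then h y else 0) := by
  have hq0 : 0 < q := hq.pos
  have hr0 : 0 < r := hq0.trans hqr
  have hq0' : 0 < q' := hq.symm.pos
  have hsum : 1 / q + 1 / q' = 1 := by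
    have := hq.inv_add_inv_eq_one
    simp only [one_div]; linarith
  have hD0 : 0 < D := by
    rw [← hD]; exact_mod_cast Module.finrank_pos
  have hDq : D / q + D / q' = D := by
    rw [div_eq_mul_one_div, div_eq_mul_one_div D q', ← mul_add, hsum, mul_one]
  have hlD : l < D := by
    have : D / r < D / q := div_lt_div_of_pos_left hD0 hq0 hqr
    linarith
  have hlq : D < l * q' := by
    have h1 : l * q' = D + D / r * q' := by
      rw [hl]; field_simp
    have : 0 < D / r * q' := by positivity
    linarith
  obtain ⟨A₀, hA₀t, hA₀1, hA₀⟩ := sw_out (E := E) D (l * q') hD hlq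
  obtain ⟨B, hBt, hB1, hB⟩ := sw_ball (E := E) D l hD hlD
  set A : ℝ≥0∞ := A₀ ^ (1 / q') with hAdef
  have hAt : A ≠ ⊤ := ENNReal.rpow_ne_top_of_nonneg (by positivity) hA₀t
  have hA1 : 1 ≤ A := ENNReal.one_le_rpow hA₀1 (by positivity)
  have hA0 : A ≠ 0 := (zero_lt_one.trans_le hA1).ne'
  have hB0 : B ≠ 0 := (zero_lt_one.trans_le hB1).ne'
  have h4A0 : 4 * A ≠ 0 := mul_ne_zero (by norm_num) hA0
  have h4At : 4 * A ≠ ⊤ := ENNReal.mul_ne_top (by norm_num) hAt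
  set θ : ℝ := r / q - 1 with hθ
  have hθ' : r / D * (D - l) = θ := by
    rw [hθ, hl]
    have : D - (D / q' + D / r) = D / q - D / r := by linarith
    rw [this]; field_simp
  set G : ℝ≥0∞ := 4 * B * (4 * A) ^ θ with hG
  have h4Aθt : (4 * A) ^ θ ≠ ⊤ := ENNReal.rpow_ne_top_of_ne_zero h4A0 h4At
  have h4Aθ0 : (4 * A) ^ θ ≠ 0 := (ENNReal.rpow_pos (pos_iff_ne_zero.2 h4A0) h4At).ne'
  have hGt : G ≠ ⊤ := ENNReal.mul_ne_top (ENNReal.mul_ne_top (by norm_num) hBt) h4Aθt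
  have hG0 : G ≠ 0 := mul_ne_zero (mul_ne_zero (by norm_num) hB0) h4Aθ0
  refine ⟨G, hGt, ?_⟩
  intro h hh hn τ hτ0 hτt
  set R : ℝ≥0∞ := (4 * A * τ⁻¹) ^ (r / D) with hR
  have hbase0 : 4 * A * τ⁻¹ ≠ 0 := mul_ne_zero h4A0 (ENNReal.inv_ne_zero.2 hτt)
  have hbaset : 4 * A * τ⁻¹ ≠ ⊤ := ENNReal.mul_ne_top h4At (ENNReal.inv_ne_top.2 hτ0)
  have hR0 : R ≠ 0 := (ENNReal.rpow_pos (pos_iff_ne_zero.2 hbase0) hbaset).ne'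
  have hRt : R ≠ ⊤ := ENNReal.rpow_ne_top_of_ne_zero hbase0 hbaset
  set P : ℝ≥0∞ := 4 * B * R ^ (D - l) with hP
  have hPG : P = G * τ ^ (-θ) := by
    rw [hP, hR, ← ENNReal.rpow_mul, hθ', hG, ENNReal.mul_rpow_of_ne_top h4At
      (ENNReal.inv_ne_top.2 hτ0), ENNReal.inv_rpow, ENNReal.rpow_neg]
    ring
  have hτθ0 : τ ^ (-θ) ≠ 0 := (ENNReal.rpow_pos (pos_iff_ne_zero.2 hτ0) hτt).ne'
  have hτθt : τ ^ (-θ) ≠ ⊤ := ENNReal.rpow_ne_top_of_ne_zero hτ0 hτt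
  have hP0 : P ≠ 0 := by rw [hPG]; exact mul_ne_zero hG0 hτθ0
  have hPt : P ≠ ⊤ := by rw [hPG]; exact ENNReal.mul_ne_top hGt hτθt
  set s : ℝ≥0∞ := τ * P⁻¹ with hs
  -- the kernels
  let kf : E → ℝ≥0∞ := fun z => if R ≤ ‖z‖ₑ then ‖z‖ₑ ^ (-l) else 0
  let kn : E → ℝ≥0∞ := fun z => if ‖z‖ₑ ≤ R then ‖z‖ₑ ^ (-l) else 0
  have hkf : Measurable kf :=
    Measurable.ite (measurableSet_le (by fun_prop) (by fun_prop)) (by fun_prop) (by fun_prop)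
  have hkn : Measurable kn :=
    Measurable.ite (measurableSet_le (by fun_prop) (by fun_prop)) (by fun_prop) (by fun_prop)
  let hi : E → ℝ≥0∞ := fun y => if s < h y then h y else 0
  have hhi : Measurable hi := Measurable.ite (measurableSet_lt (by fun_prop) hh) hh (by fun_prop)
  have hfar : ∀ x : E, ∫⁻ y, kf (x - y) * h y ≤ τ / 4 := by
    intro x
    refine (sw_holder q q' hq (fun y => kf (x - y)) h (by fun_prop) hh hn).trans ?_
    rw [lintegral_sub_left_eq_self (fun z => kf z ^ q') x]
    have e : ∀ z, kf z ^ q' = if R ≤ ‖z‖ₑ then ‖z‖ₑ ^ (-(l * q')) else 0 := by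
      intro z
      simp only [kf]
      split_ifs
      · rw [← ENNReal.rpow_mul, neg_mul]
      · exact ENNReal.zero_rpow_of_pos hq0'
    simp only [e]
    calc _ ≤ (A₀ * R ^ (D - l * q')) ^ (1 / q') := by
          gcongr
          exact hA₀ R hR0 hRt
      _ = A * (4 * A * τ⁻¹)⁻¹ := by
          have hexp : r / D * ((D - l * q') * (1 / q')) = -1 := by
            rw [hl]; field_simp; ring
          rw [ENNReal.mul_rpow_of_nonneg _ _ (by positivity), hR, ← ENNReal.rpow_mul,
            ← ENNReal.rpow_mul, hexp, ENNReal.rpow_neg_one]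
      _ = τ / 4 := by
          rw [ENNReal.mul_inv (Or.inl h4A0) (Or.inl h4At), inv_inv,
            ENNReal.mul_inv (Or.inl (by norm_num)) (Or.inl (by norm_num)), div_eq_mul_inv]
          calc A * (4⁻¹ * A⁻¹ * τ) = (A * A⁻¹) * (τ * 4⁻¹) := by ring
            _ = _ := by rw [ENNReal.mul_inv_cancel hA0 hAt, one_mul]
  have hlow : ∀ x : E, ∫⁻ y, kn (x - y) * s ≤ τ / 4 := by
    intro x
    rw [lintegral_mul_const _ (by fun_prop), lintegral_sub_left_eq_self kn x]
    calc _ ≤ B * R ^ (D - l) * s := by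
          gcongr
          exact hB R hR0 hRt
      _ = (4 * 4⁻¹) * (B * R ^ (D - l) * s) := by
          rw [ENNReal.mul_inv_cancel (by norm_num) (by norm_num), one_mul]
      _ = (P * P⁻¹) * (τ * 4⁻¹) := by rw [hs, hP]; ring
      _ = τ / 4 := by rw [ENNReal.mul_inv_cancel hP0 hPt, one_mul, div_eq_mul_inv]
  let H : E → ℝ≥0∞ := fun x => ∫⁻ y, kn (x - y) * hi y
  have hHm : Measurable H := by
    refine Measurable.lintegral_prod_right' (f := fun p : E × E => kn (p.1 - p.2) * hi p.2) ?_
    fun_prop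
  have hsplit : ∀ x : E, ∫⁻ y, ‖x - y‖ₑ ^ (-l) * h y ≤ τ / 4 + τ / 4 + H x := by
    intro x
    calc ∫⁻ y, ‖x - y‖ₑ ^ (-l) * h y
        ≤ ∫⁻ y, (kf (x - y) * h y + kn (x - y) * s + kn (x - y) * hi y) := by
          refine lintegral_mono fun y => ?_
          by_cases h1 : R ≤ ‖x - y‖ₑ
          · have : kf (x - y) = ‖x - y‖ₑ ^ (-l) := by simp [kf, h1]
            rw [this, add_assoc]
            exact le_self_add
          · have h2 : kn (x - y) = ‖x - y‖ₑ ^ (-l) := by simp [kn, (not_le.1 h1).le]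
            rw [h2]
            by_cases h3 : s < h y
            · have : hi y = h y := by simp [hi, h3]
              rw [this]
              exact le_add_self
            · calc ‖x - y‖ₑ ^ (-l) * h y ≤ ‖x - y‖ₑ ^ (-l) * s := by gcongr; exact not_lt.1 h3
                _ ≤ kf (x - y) * h y + ‖x - y‖ₑ ^ (-l) * s := le_add_self
                _ ≤ _ := le_self_add
      _ = (∫⁻ y, kf (x - y) * h y) + (∫⁻ y, kn (x - y) * s) + H x := by
          rw [lintegral_add_left (by fun_prop), lintegral_add_left (by fun_prop)]
      _ ≤ _ := by
          gcongr
          · exact hfar x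
          · exact hlow x
  have hsub : {x : E | τ < ∫⁻ y, ‖x - y‖ₑ ^ (-l) * h y} ⊆ {x | τ / 2 ≤ H x} := by
    intro x hx
    by_contra hcon
    have hlt : H x < τ / 2 := not_le.1 hcon
    have h1 : τ < τ / 4 + τ / 4 + H x := lt_of_lt_of_le hx (hsplit x)
    have h2 : τ / 4 + τ / 4 = τ / 2 := by
      rw [← mul_two, div_eq_mul_inv, div_eq_mul_inv, mul_assoc]
      congr 1
      rw [show (4 : ℝ≥0∞) = 2 * 2 by norm_num, ENNReal.mul_inv (by norm_num) (by norm_num), mul_assoc,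
        ENNReal.inv_mul_cancel (by norm_num) (by norm_num), mul_one]
    rw [h2] at h1
    have h3 : τ / 2 + H x < τ / 2 + τ / 2 :=
      ENNReal.add_lt_add_left (ENNReal.div_ne_top hτt (by norm_num)) hlt
    rw [ENNReal.add_halves] at h3
    exact lt_irrefl _ (h1.trans h3)
  have hHint : ∫⁻ x, H x ≤ B * R ^ (D - l) * ∫⁻ y, hi y := by
    calc ∫⁻ x, H x = ∫⁻ y, ∫⁻ x, kn (x - y) * hi y := by
          refine lintegral_lintegral_swap (f := fun x y => kn (x - y) * hi y) ?_
          refine Measurable.aemeasurable ?_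
          simp only [Function.uncurry_def]
          fun_prop
      _ = ∫⁻ y, (∫⁻ z, kn z) * hi y := by
          refine lintegral_congr fun y => ?_
          rw [lintegral_mul_const _ (by fun_prop), lintegral_sub_right_eq_self kn y]
      _ = (∫⁻ z, kn z) * ∫⁻ y, hi y := lintegral_const_mul _ hhi
      _ ≤ _ := by
          gcongr
          exact hB R hR0 hRt
  have htau_ne : τ / 2 ≠ 0 := ENNReal.div_ne_zero.2 ⟨hτ0, by norm_num⟩
  have htau_top : τ / 2 ≠ ⊤ := ENNReal.div_ne_top hτt (by norm_num)
  calc volume {x : E | τ < ∫⁻ y, ‖x - y‖ₑ ^ (-l) * h y}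
      ≤ volume {x | τ / 2 ≤ H x} := measure_mono hsub
    _ ≤ (∫⁻ x, H x) / (τ / 2) := meas_ge_le_lintegral_div hHm.aemeasurable htau_ne htau_top
    _ ≤ (B * R ^ (D - l) * ∫⁻ y, hi y) / (τ / 2) := by gcongr
    _ = 2 * (B * R ^ (D - l)) * τ⁻¹ * ∫⁻ y, hi y := by
        rw [div_eq_mul_inv, ENNReal.inv_div (by norm_num) (by norm_num), div_eq_mul_inv]; ring
    _ ≤ P * τ⁻¹ * ∫⁻ y, hi y := by
        gcongr
        rw [hP, mul_assoc]
        gcongr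
        norm_num
    _ = G * τ ^ (-(r / q)) * ∫⁻ y, hi y := by
        congr 1
        rw [hPG, mul_assoc, ← ENNReal.rpow_neg_one, ← ENNReal.rpow_add _ _ hτ0 hτt]
        congr 2
        rw [hθ]; ring
    _ ≤ _ := by
        gcongr with y
        simp only [hi]
        split_ifs with h1 h2
        · exact le_rfl
        · exfalso
          apply h2
          have h3 : τ * P⁻¹ * P < h y * P := ENNReal.mul_lt_mul_left hP0 hPt h1
          rw [mul_assoc, ENNReal.inv_mul_cancel hP0 hPt, mul_one, hPG] at h3
          have h4 : τ * τ ^ θ < h y * (G * τ ^ (-θ)) * τ ^ θ :=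
            ENNReal.mul_lt_mul_left (ENNReal.rpow_pos (pos_iff_ne_zero.2 hτ0) hτt).ne'
              (ENNReal.rpow_ne_top_of_ne_zero hτ0 hτt) h3
          have h5 : τ * τ ^ θ = τ ^ (r / q) := by
            conv_lhs => rw [← ENNReal.rpow_one τ, ← ENNReal.rpow_mul, ← ENNReal.rpow_add _ _ hτ0 hτt]
            congr 1
            rw [hθ]; ring
          have h6 : h y * (G * τ ^ (-θ)) * τ ^ θ = G * h y := by
            calc _ = G * h y * (τ ^ (-θ) * τ ^ θ) := by ring
              _ = _ := by rw [← ENNReal.rpow_add _ _ hτ0 hτt]; simp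
          rw [h5, h6] at h4
          have := ENNReal.rpow_lt_rpow h4 (show 0 < q / r by positivity)
          rwa [← ENNReal.rpow_mul, div_mul_div_cancel₀ hq0.ne', div_self hr0.ne',
            ENNReal.rpow_one] at this
        · exact zero_le
        · exact le_rfl

lemma sw_hls (D l q q' r : ℝ) (hD : (Module.finrank ℝ E : ℝ) = D) (hq : q.HolderConjugate q')
    (hqr : q < r) (hl : l = D / q' + D / r) :
    ∃ C : ℝ≥0∞, C ≠ ⊤ ∧ ∀ h : E → ℝ≥0∞, Measurable h → ∫⁻ y, h y ^ q ≤ 1 →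
      ∫⁻ x : E, (∫⁻ y, ‖x - y‖ₑ ^ (-l) * h y) ^ r ≤ C := by
  have hq0 : 0 < q := hq.pos
  have hq1 : 1 < q := hq.lt
  have hr0 : 0 < r := hq0.trans hqr
  obtain ⟨G, hGt, hG⟩ := sw_weak (E := E) D l q q' r hD hq hqr hl
  set k : ℝ := r - r / q with hk
  have hk0 : 0 < k := by
    have : r / q < r := div_lt_self hr0 hq1
    linarith
  refine ⟨ENNReal.ofReal r * (G * (ENNReal.ofReal k⁻¹ * G ^ (q - 1))), ?_, ?_⟩
  · refine ENNReal.mul_ne_top ENNReal.ofReal_ne_top (ENNReal.mul_ne_top hGt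
      (ENNReal.mul_ne_top ENNReal.ofReal_ne_top (ENNReal.rpow_ne_top_of_nonneg (by linarith) hGt)))
  intro h hh hn
  let T : E → ℝ≥0∞ := fun x => ∫⁻ y, ‖x - y‖ₑ ^ (-l) * h y
  have hT : Measurable T := by
    refine Measurable.lintegral_prod_right' (f := fun p : E × E => ‖p.1 - p.2‖ₑ ^ (-l) * h p.2) ?_
    fun_prop
  calc ∫⁻ x : E, T x ^ r
      ≤ ∫⁻ x : E, ENNReal.ofReal r * ∫⁻ t in Set.Ioi (0 : ℝ),
          ENNReal.ofReal t ^ (r - 1) * (if ENNReal.ofReal t < T x then 1 else 0) :=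
        lintegral_mono fun x => sw_layer_le r hr0 (T x)
    _ = ENNReal.ofReal r * ∫⁻ x : E, ∫⁻ t in Set.Ioi (0 : ℝ),
          ENNReal.ofReal t ^ (r - 1) * (if ENNReal.ofReal t < T x then 1 else 0) :=
        lintegral_const_mul' _ _ ENNReal.ofReal_ne_top
    _ = ENNReal.ofReal r * ∫⁻ t in Set.Ioi (0 : ℝ), ∫⁻ x : E,
          ENNReal.ofReal t ^ (r - 1) * (if ENNReal.ofReal t < T x then 1 else 0) := by
        rw [lintegral_lintegral_swap]
        refine Measurable.aemeasurable ?_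
        simp only [Function.uncurry_def]
        refine Measurable.mul (by fun_prop) ?_
        exact Measurable.ite (measurableSet_lt (by fun_prop) (by fun_prop)) (by fun_prop)
          (by fun_prop)
    _ ≤ ENNReal.ofReal r * ∫⁻ t in Set.Ioi (0 : ℝ), ∫⁻ y : E,
          G * (h y * (ENNReal.ofReal t ^ (k - 1) *
            (if ENNReal.ofReal t < (G * h y) ^ (q / r) then 1 else 0))) := by
        refine mul_le_mul_right (setLIntegral_mono' measurableSet_Ioi fun t ht => ?_) _
        have ht0 : ENNReal.ofReal t ≠ 0 := by simpa using ht
        have htt : ENNReal.ofReal t ≠ ⊤ := ENNReal.ofReal_ne_top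
        rw [lintegral_const_mul _ (Measurable.ite (measurableSet_lt (by fun_prop) (by fun_prop))
          (by fun_prop) (by fun_prop))]
        have e1 : ∫⁻ x : E, (if ENNReal.ofReal t < T x then 1 else 0 : ℝ≥0∞)
            = volume {x : E | ENNReal.ofReal t < T x} := by
          rw [← lintegral_indicator_one (measurableSet_lt (by fun_prop) hT)]
          refine lintegral_congr fun x => ?_
          simp [Set.indicator]
        rw [e1]
        calc _ ≤ ENNReal.ofReal t ^ (r - 1) * (G * ENNReal.ofReal t ^ (-(r / q)) *
              ∫⁻ y, (if ENNReal.ofReal t < (G * h y) ^ (q / r) then h y else 0)) := by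
              gcongr
              exact hG h hh hn _ ht0 htt
          _ = (G * ENNReal.ofReal t ^ (k - 1)) *
              ∫⁻ y, (if ENNReal.ofReal t < (G * h y) ^ (q / r) then h y else 0) := by
              rw [show k - 1 = (r - 1) + (-(r / q)) by rw [hk]; ring,
                ENNReal.rpow_add _ _ ht0 htt]
              ring
          _ = _ := by
              rw [← lintegral_const_mul' _ _
                (ENNReal.mul_ne_top hGt (ENNReal.rpow_ne_top_of_ne_zero ht0 htt))]
              refine lintegral_congr fun y => ?_
              split_ifs
              · ring
              · simp
    _ = ENNReal.ofReal r * ∫⁻ y : E, ∫⁻ t in Set.Ioi (0 : ℝ),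
          G * (h y * (ENNReal.ofReal t ^ (k - 1) *
            (if ENNReal.ofReal t < (G * h y) ^ (q / r) then 1 else 0))) := by
        rw [lintegral_lintegral_swap]
        refine Measurable.aemeasurable ?_
        simp only [Function.uncurry_def]
        refine Measurable.mul (by fun_prop) (Measurable.mul (by fun_prop)
          (Measurable.mul (by fun_prop) ?_))
        exact Measurable.ite (measurableSet_lt (by fun_prop) (by fun_prop)) (by fun_prop)
          (by fun_prop)
    _ ≤ ENNReal.ofReal r * ∫⁻ y : E, (G * (ENNReal.ofReal k⁻¹ * G ^ (q - 1))) * h y ^ q := by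
        gcongr with y
        have hm : Measurable fun t : ℝ => (ENNReal.ofReal t ^ (k - 1) *
            (if ENNReal.ofReal t < (G * h y) ^ (q / r) then 1 else 0) : ℝ≥0∞) := by
          refine Measurable.mul (by fun_prop) ?_
          exact Measurable.ite (measurableSet_lt (by fun_prop) (by fun_prop)) (by fun_prop)
            (by fun_prop)
        rw [lintegral_const_mul _ (hm.const_mul _), lintegral_const_mul _ hm]
        calc _ ≤ G * (h y * (ENNReal.ofReal k⁻¹ * ((G * h y) ^ (q / r)) ^ k)) := by
              gcongr
              exact sw_layer_ge k hk0 _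
          _ = G * (ENNReal.ofReal k⁻¹ * G ^ (q - 1)) * (h y * h y ^ (q - 1)) := by
              rw [← ENNReal.rpow_mul, show q / r * k = q - 1 by rw [hk]; field_simp,
                ENNReal.mul_rpow_of_nonneg _ _ (by linarith)]
              ring
          _ = _ := by
              congr 1
              conv_lhs => rw [← ENNReal.rpow_one (h y), ← ENNReal.rpow_mul,
                ← ENNReal.rpow_add_of_nonneg _ _ zero_le_one (by linarith)]
              congr 1; ring
    _ ≤ _ := by
        rw [lintegral_const_mul _ (by fun_prop)]
        refine mul_le_mul_right ?_ _
        calc _ ≤ G * (ENNReal.ofReal k⁻¹ * G ^ (q - 1)) * 1 := mul_le_mul_right hn _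
          _ = _ := mul_one _

lemma sw_r1 (D q q' r γ β : ℝ) (hD : (Module.finrank ℝ E : ℝ) = D) (hq : q.HolderConjugate q')
    (hqr : q ≤ r) (hγ : γ + β = D / q' + D / r) (hβ : β * q' < D) :
    ∃ C : ℝ≥0∞, C ≠ ⊤ ∧ ∀ h : E → ℝ≥0∞, Measurable h → ∫⁻ y, h y ^ q ≤ 1 →
      ∫⁻ x : E, (∫⁻ y, ((if ‖y‖ₑ ≤ ‖x‖ₑ then 1 else 0) * ‖x‖ₑ ^ (-γ) * ‖y‖ₑ ^ (-β)) * h y) ^ r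
        ≤ C := by
  have hq0 : 0 < q := hq.pos
  have hq0' : 0 < q' := hq.symm.pos
  have hmul : q * q' = q + q' := hq.mul_eq_add
  have hlt : β / q < (D - β) / q' := by
    rw [div_lt_div_iff₀ hq0 hq0']
    nlinarith
  obtain ⟨α, hα1, hα2⟩ := exists_between hlt
  rw [div_lt_iff₀ hq0] at hα1
  rw [lt_div_iff₀ hq0'] at hα2
  obtain ⟨A₀, hA₀t, -, hA₀⟩ := sw_ball (E := E) D (β * q') hD hβ
  obtain ⟨A₁, hA₁t, -, hA₁⟩ := sw_ball (E := E) D (β + α * q') hD (by linarith)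
  obtain ⟨A₂, hA₂t, -, hA₂⟩ := sw_out (E := E) D (D - β + α * q) hD (by linarith)
  set A := A₀ + A₁ + A₂ with hA
  have hAt : A ≠ ⊤ := by simp [hA, hA₀t, hA₁t, hA₂t]
  have hA0 : A₀ ≤ A := by rw [hA, add_assoc]; exact le_self_add
  have hA1 : A₁ ≤ A := by rw [hA, add_right_comm]; exact le_add_self
  have hA2 : A₂ ≤ A := le_add_self
  refine ⟨A ^ ((r - q) / q') * (A ^ (q / q') * A), ?_, ?_⟩
  · exact ENNReal.mul_ne_top (ENNReal.rpow_ne_top_of_nonneg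
      (div_nonneg (by linarith) hq0'.le) hAt)
      (ENNReal.mul_ne_top (ENNReal.rpow_ne_top_of_nonneg (by positivity) hAt) hAt)
  intro h hh hn
  refine sw_hardy D q q' r γ β α hq hqr hγ (fun x y => if ‖y‖ₑ ≤ ‖x‖ₑ then 1 else 0)
    ?_ ?_ A ?_ ?_ ?_ h hh hn
  · simp only [Function.uncurry_def]
    exact Measurable.ite (measurableSet_le (by fun_prop) (by fun_prop)) (by fun_prop) (by fun_prop)
  · intro x y
    split_ifs <;> simp
  · intro x hx
    simp only [ite_mul, one_mul, zero_mul]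
    refine (hA₀ ‖x‖ₑ (enorm_ne_zero.2 hx) enorm_ne_top).trans ?_
    gcongr
  · intro x hx
    simp only [ite_mul, one_mul, zero_mul]
    refine (hA₁ ‖x‖ₑ (enorm_ne_zero.2 hx) enorm_ne_top).trans ?_
    gcongr
  · intro y hy
    simp only [ite_mul, one_mul, zero_mul]
    refine (hA₂ ‖y‖ₑ (enorm_ne_zero.2 hy) enorm_ne_top).trans ?_
    rw [show D - (D - β + α * q) = β - α * q by ring]
    gcongr

lemma sw_r2 (D q q' r γ β : ℝ) (hD : (Module.finrank ℝ E : ℝ) = D) (hq : q.HolderConjugate q')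
    (hqr : q ≤ r) (hγ : γ + β = D / q' + D / r) (hβ : D < β * q') :
    ∃ C : ℝ≥0∞, C ≠ ⊤ ∧ ∀ h : E → ℝ≥0∞, Measurable h → ∫⁻ y, h y ^ q ≤ 1 →
      ∫⁻ x : E, (∫⁻ y, ((if ‖x‖ₑ ≤ ‖y‖ₑ then 1 else 0) * ‖x‖ₑ ^ (-γ) * ‖y‖ₑ ^ (-β)) * h y) ^ r
        ≤ C := by
  have hq0 : 0 < q := hq.pos
  have hq0' : 0 < q' := hq.symm.pos
  have hmul : q * q' = q + q' := hq.mul_eq_add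
  have hlt : (D - β) / q' < β / q := by
    rw [div_lt_div_iff₀ hq0' hq0]
    nlinarith
  obtain ⟨α, hα1, hα2⟩ := exists_between hlt
  rw [div_lt_iff₀ hq0'] at hα1
  rw [lt_div_iff₀ hq0] at hα2
  obtain ⟨A₀, hA₀t, -, hA₀⟩ := sw_out (E := E) D (β * q') hD hβ
  obtain ⟨A₁, hA₁t, -, hA₁⟩ := sw_out (E := E) D (β + α * q') hD (by linarith)
  obtain ⟨A₂, hA₂t, -, hA₂⟩ := sw_ball (E := E) D (D - β + α * q) hD (by linarith)
  set A := A₀ + A₁ + A₂ with hA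
  have hAt : A ≠ ⊤ := by simp [hA, hA₀t, hA₁t, hA₂t]
  have hA0 : A₀ ≤ A := by rw [hA, add_assoc]; exact le_self_add
  have hA1 : A₁ ≤ A := by rw [hA, add_right_comm]; exact le_add_self
  have hA2 : A₂ ≤ A := le_add_self
  refine ⟨A ^ ((r - q) / q') * (A ^ (q / q') * A), ?_, ?_⟩
  · exact ENNReal.mul_ne_top (ENNReal.rpow_ne_top_of_nonneg
      (div_nonneg (by linarith) hq0'.le) hAt)
      (ENNReal.mul_ne_top (ENNReal.rpow_ne_top_of_nonneg (by positivity) hAt) hAt)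
  intro h hh hn
  refine sw_hardy D q q' r γ β α hq hqr hγ (fun x y => if ‖x‖ₑ ≤ ‖y‖ₑ then 1 else 0)
    ?_ ?_ A ?_ ?_ ?_ h hh hn
  · simp only [Function.uncurry_def]
    exact Measurable.ite (measurableSet_le (by fun_prop) (by fun_prop)) (by fun_prop) (by fun_prop)
  · intro x y
    split_ifs <;> simp
  · intro x hx
    simp only [ite_mul, one_mul, zero_mul]
    refine (hA₀ ‖x‖ₑ (enorm_ne_zero.2 hx) enorm_ne_top).trans ?_
    gcongr
  · intro x hx
    simp only [ite_mul, one_mul, zero_mul]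
    refine (hA₁ ‖x‖ₑ (enorm_ne_zero.2 hx) enorm_ne_top).trans ?_
    gcongr
  · intro y hy
    simp only [ite_mul, one_mul, zero_mul]
    refine (hA₂ ‖y‖ₑ (enorm_ne_zero.2 hy) enorm_ne_top).trans ?_
    rw [show D - (D - β + α * q) = β - α * q by ring]
    gcongr

lemma sw_cmp (u v k : ℝ≥0∞) (e : ℝ) (he : 0 ≤ e) (hv : v ≠ ⊤) (hk0 : k ≠ 0) (hkt : k ≠ ⊤)
    (huv : u ≤ k * v) : v ^ (-e) ≤ k ^ e * u ^ (-e) := by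
  have h1 : v ^ (-e) = k ^ e * (k * v) ^ (-e) := by
    rw [ENNReal.mul_rpow_of_ne_top hkt hv, ← mul_assoc, ← ENNReal.rpow_add _ _ hk0 hkt]
    simp
  rw [h1]
  gcongr k ^ e * ?_
  rw [ENNReal.rpow_neg, ENNReal.rpow_neg, ENNReal.inv_le_inv]
  gcongr

/-- The comparable region kernel. -/
def swK (e a : ℝ) (x y : E) : ℝ≥0∞ :=
  if ‖y‖ₑ ≤ 2 * ‖x‖ₑ ∧ ‖x‖ₑ ≤ 2 * ‖y‖ₑ then ‖x‖ₑ ^ (-e) * ‖x - y‖ₑ ^ (-a) else 0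

lemma swK_meas (e a : ℝ) : Measurable (Function.uncurry (swK (E := E) e a)) := by
  unfold swK
  simp only [Function.uncurry_def]
  refine Measurable.ite ?_ (by fun_prop) (by fun_prop)
  have m1 : MeasurableSet {p : E × E | ‖p.2‖ₑ ≤ 2 * ‖p.1‖ₑ} :=
    measurableSet_le (by fun_prop) (by fun_prop)
  have m2 : MeasurableSet {p : E × E | ‖p.1‖ₑ ≤ 2 * ‖p.2‖ₑ} :=
    measurableSet_le (by fun_prop) (by fun_prop)
  exact m1.inter m2

lemma sw_sub_le (x y : E) (h : ‖y‖ₑ ≤ 2 * ‖x‖ₑ) : ‖x - y‖ₑ ≤ 3 * ‖x‖ₑ := by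
  calc ‖x - y‖ₑ ≤ ‖x‖ₑ + ‖y‖ₑ := enorm_sub_le
    _ ≤ ‖x‖ₑ + 2 * ‖x‖ₑ := by gcongr
    _ = 3 * ‖x‖ₑ := by ring

lemma sw_sub_le' (x y : E) (h : ‖x‖ₑ ≤ 2 * ‖y‖ₑ) : ‖x - y‖ₑ ≤ 3 * ‖y‖ₑ := by
  rw [enorm_sub_rev]; exact sw_sub_le y x h

lemma sw_r3 (D q q' r a e : ℝ) (hD : (Module.finrank ℝ E : ℝ) = D) (hq : q.HolderConjugate q')
    (hqr : q ≤ r) (haD : a < D) (he : 0 ≤ e) (hae : a + e = D / q' + D / r) :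
    ∃ C : ℝ≥0∞, C ≠ ⊤ ∧ ∀ h : E → ℝ≥0∞, Measurable h → ∫⁻ y, h y ^ q ≤ 1 →
      ∫⁻ x : E, (∫⁻ y, swK e a x y * h y) ^ r ≤ C := by
  have hq0 : 0 < q := hq.pos
  have hr0 : 0 < r := hq0.trans_le hqr
  have hq0' : 0 < q' := hq.symm.pos
  have h3t : ∀ s : ℝ, (3 : ℝ≥0∞) ^ s ≠ ⊤ := fun s =>
    ENNReal.rpow_ne_top_of_ne_zero (by norm_num) (by norm_num)
  have h2t : ∀ s : ℝ, (2 : ℝ≥0∞) ^ s ≠ ⊤ := fun s =>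
    ENNReal.rpow_ne_top_of_ne_zero (by norm_num) (by norm_num)
  rcases hqr.lt_or_eq with hlt | heq
  · obtain ⟨C, hCt, hC⟩ := sw_hls (E := E) D (a + e) q q' r hD hq hlt hae
    refine ⟨((3 : ℝ≥0∞) ^ e) ^ r * C, ENNReal.mul_ne_top
      (ENNReal.rpow_ne_top_of_nonneg hr0.le (h3t e)) hCt, ?_⟩
    intro h hh hn
    have hpt : ∀ x : E, ∫⁻ y, swK e a x y * h y ≤
        3 ^ e * ∫⁻ y, ‖x - y‖ₑ ^ (-(a + e)) * h y := by
      intro x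
      rw [← lintegral_const_mul _ (by fun_prop)]
      refine lintegral_mono_ae ?_
      filter_upwards [sw_ae_ne x] with y hy
      rw [← mul_assoc]
      gcongr
      unfold swK
      split_ifs with hc
      · have h1 := sw_cmp ‖x - y‖ₑ ‖x‖ₑ 3 e he enorm_ne_top (by norm_num) (by norm_num)
          (sw_sub_le x y hc.1)
        calc ‖x‖ₑ ^ (-e) * ‖x - y‖ₑ ^ (-a) ≤ 3 ^ e * ‖x - y‖ₑ ^ (-e) * ‖x - y‖ₑ ^ (-a) := by gcongr
          _ = _ := by
            rw [mul_assoc, sw_rpow_add _ (sub_ne_zero.2 (Ne.symm hy))]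
            congr 2; ring
      · exact zero_le
    calc _ ≤ ∫⁻ x : E, (3 ^ e * ∫⁻ y, ‖x - y‖ₑ ^ (-(a + e)) * h y) ^ r := by
          gcongr with x
          exact hpt x
      _ = (3 ^ e) ^ r * ∫⁻ x : E, (∫⁻ y, ‖x - y‖ₑ ^ (-(a + e)) * h y) ^ r := by
          rw [← lintegral_const_mul' _ _ (ENNReal.rpow_ne_top_of_nonneg hr0.le (h3t e))]
          refine lintegral_congr fun x => ?_
          rw [ENNReal.mul_rpow_of_nonneg _ _ hr0.le]
      _ ≤ _ := by
          gcongr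
          exact hC h hh hn
  · have hsum : 1 / q + 1 / q' = 1 := by
      have := hq.inv_add_inv_eq_one
      simp only [one_div]; linarith
    have hDq : D / q + D / q' = D := by
      rw [div_eq_mul_one_div, div_eq_mul_one_div D q', ← mul_add, hsum, mul_one]
    have hDe : D - a = e := by rw [← heq] at hae; linarith
    obtain ⟨B, hBt, -, hB⟩ := sw_ball (E := E) D a hD haD
    set A : ℝ≥0∞ := 2 ^ e * (B * 3 ^ e) with hA
    have hAt : A ≠ ⊤ := ENNReal.mul_ne_top (h2t e) (ENNReal.mul_ne_top hBt (h3t e))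
    refine ⟨A ^ (q / q') * A, ENNReal.mul_ne_top
      (ENNReal.rpow_ne_top_of_nonneg (by positivity) hAt) hAt, ?_⟩
    intro h hh hn
    rw [← heq]
    let kn : ℝ≥0∞ → E → ℝ≥0∞ := fun R z => if ‖z‖ₑ ≤ R then ‖z‖ₑ ^ (-a) else 0
    have hkn : ∀ R, Measurable (kn R) := fun R =>
      Measurable.ite (measurableSet_le (by fun_prop) (by fun_prop)) (by fun_prop) (by fun_prop)
    have hball : ∀ x : E, x ≠ 0 → ‖x‖ₑ ^ (-e) * ∫⁻ z, kn (3 * ‖x‖ₑ) z ≤ B * 3 ^ e := by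
      intro x hx
      calc ‖x‖ₑ ^ (-e) * ∫⁻ z, kn (3 * ‖x‖ₑ) z
          ≤ ‖x‖ₑ ^ (-e) * (B * (3 * ‖x‖ₑ) ^ (D - a)) := by
            gcongr
            exact hB _ (mul_ne_zero (by norm_num) (enorm_ne_zero.2 hx))
              (ENNReal.mul_ne_top (by norm_num) enorm_ne_top)
        _ = B * 3 ^ e * (‖x‖ₑ ^ (-e) * ‖x‖ₑ ^ e) := by
            rw [hDe, ENNReal.mul_rpow_of_nonneg _ _ he]; ring
        _ = _ := by rw [sw_rpow_add x hx]; simp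
    have h2e : (1 : ℝ≥0∞) ≤ 2 ^ e := by
      have := ENNReal.rpow_le_rpow_of_exponent_le (x := 2) (by norm_num) he
      simpa using this
    have hS := sw_schur q q' 0 hq (swK (E := E) e a) (swK_meas e a) A A
      (by
        intro x hx
        simp only [zero_mul, neg_zero, ENNReal.rpow_zero, mul_one]
        calc ∫⁻ y, swK e a x y ≤ ∫⁻ y, ‖x‖ₑ ^ (-e) * kn (3 * ‖x‖ₑ) (x - y) := by
              gcongr with y
              unfold swK
              split_ifs with hc
              · simp [kn, sw_sub_le x y hc.1]
              · exact zero_le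
          _ = ‖x‖ₑ ^ (-e) * ∫⁻ z, kn (3 * ‖x‖ₑ) z := by
              have := hkn (3 * ‖x‖ₑ)
              rw [lintegral_const_mul _ (by fun_prop), lintegral_sub_left_eq_self (kn _) x]
          _ ≤ B * 3 ^ e := hball x hx
          _ = 1 * (B * 3 ^ e) := (one_mul _).symm
          _ ≤ A := by rw [hA]; gcongr)
      (by
        intro y hy
        simp only [zero_mul, neg_zero, ENNReal.rpow_zero, mul_one]
        calc ∫⁻ x, swK e a x y ≤ ∫⁻ x, 2 ^ e * (‖y‖ₑ ^ (-e) * kn (3 * ‖y‖ₑ) (x - y)) := by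
              gcongr with x
              unfold swK
              split_ifs with hc
              · have h1 := sw_cmp ‖y‖ₑ ‖x‖ₑ 2 e he enorm_ne_top (by norm_num) (by norm_num) hc.1
                have h2 : kn (3 * ‖y‖ₑ) (x - y) = ‖x - y‖ₑ ^ (-a) := by
                  simp [kn, sw_sub_le' x y hc.2]
                rw [h2, ← mul_assoc]
                gcongr
              · exact zero_le
          _ = 2 ^ e * (‖y‖ₑ ^ (-e) * ∫⁻ z, kn (3 * ‖y‖ₑ) z) := by
              have := hkn (3 * ‖y‖ₑ)
              rw [lintegral_const_mul _ (by fun_prop), lintegral_const_mul _ (by fun_prop),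
                lintegral_sub_right_eq_self (kn _) y]
          _ ≤ A := by
              rw [hA]
              exact mul_le_mul_right (hball y hy) _) h hh
    calc _ ≤ _ := hS
      _ ≤ A ^ (q / q') * A * 1 := mul_le_mul_right hn _
      _ = _ := mul_one _

lemma sw_half (x y : E) (h : 2 * ‖y‖ₑ ≤ ‖x‖ₑ) : ‖x‖ₑ ≤ 2 * ‖x - y‖ₑ := by
  rw [← ofReal_norm, ← ofReal_norm, show (2 : ℝ≥0∞) = ENNReal.ofReal 2 by simp,
    ← ENNReal.ofReal_mul (by norm_num)] at h ⊢
  rw [ENNReal.ofReal_le_ofReal_iff (norm_nonneg _)] at h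
  refine ENNReal.ofReal_le_ofReal ?_
  have := norm_sub_norm_le x y
  linarith

lemma sw_pointwise (a b c : ℝ) (ha : 0 < a) (x y : E) (hx : x ≠ 0) (hy : y ≠ 0) :
    ‖x‖ₑ ^ (-c) * ‖x - y‖ₑ ^ (-a) * ‖y‖ₑ ^ (-b) ≤ 2 ^ (a + |b|) *
      (((if ‖y‖ₑ ≤ ‖x‖ₑ then 1 else 0) * ‖x‖ₑ ^ (-(a + c)) * ‖y‖ₑ ^ (-b)) +
       ((if ‖x‖ₑ ≤ ‖y‖ₑ then 1 else 0) * ‖x‖ₑ ^ (-c) * ‖y‖ₑ ^ (-(a + b))) +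
       swK (b + c) a x y) := by
  have h2a : (2 : ℝ≥0∞) ^ a ≤ 2 ^ (a + |b|) :=
    ENNReal.rpow_le_rpow_of_exponent_le (by norm_num) (by linarith [abs_nonneg b])
  have h2b : (2 : ℝ≥0∞) ^ |b| ≤ 2 ^ (a + |b|) :=
    ENNReal.rpow_le_rpow_of_exponent_le (by norm_num) (by linarith)
  by_cases c1 : 2 * ‖y‖ₑ ≤ ‖x‖ₑ
  · have hle : ‖y‖ₑ ≤ ‖x‖ₑ := le_trans (by rw [two_mul]; exact le_self_add) c1
    have h1 := sw_cmp ‖x‖ₑ ‖x - y‖ₑ 2 a ha.le enorm_ne_top (by norm_num) (by norm_num)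
      (sw_half x y c1)
    rw [if_pos hle, one_mul]
    calc ‖x‖ₑ ^ (-c) * ‖x - y‖ₑ ^ (-a) * ‖y‖ₑ ^ (-b)
        ≤ ‖x‖ₑ ^ (-c) * (2 ^ (a + |b|) * ‖x‖ₑ ^ (-a)) * ‖y‖ₑ ^ (-b) := by
          gcongr
          exact h1.trans (by gcongr)
      _ = 2 ^ (a + |b|) * (‖x‖ₑ ^ (-(a + c)) * ‖y‖ₑ ^ (-b)) := by
          rw [show -(a + c) = -c + -a by ring, ← sw_rpow_add x hx]; ring
      _ ≤ _ := by
          gcongr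
          rw [add_assoc]
          exact le_self_add
  by_cases c2 : 2 * ‖x‖ₑ ≤ ‖y‖ₑ
  · have hle : ‖x‖ₑ ≤ ‖y‖ₑ := le_trans (by rw [two_mul]; exact le_self_add) c2
    have h1 := sw_cmp ‖y‖ₑ ‖x - y‖ₑ 2 a ha.le enorm_ne_top (by norm_num) (by norm_num)
      (by rw [enorm_sub_rev]; exact sw_half y x c2)
    rw [if_pos hle, one_mul]
    calc ‖x‖ₑ ^ (-c) * ‖x - y‖ₑ ^ (-a) * ‖y‖ₑ ^ (-b)
        ≤ ‖x‖ₑ ^ (-c) * (2 ^ (a + |b|) * ‖y‖ₑ ^ (-a)) * ‖y‖ₑ ^ (-b) := by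
          gcongr
          exact h1.trans (by gcongr)
      _ = 2 ^ (a + |b|) * (‖x‖ₑ ^ (-c) * ‖y‖ₑ ^ (-(a + b))) := by
          rw [show -(a + b) = -a + -b by ring, ← sw_rpow_add y hy]; ring
      _ ≤ _ := by
          gcongr
          rw [add_right_comm]
          exact le_add_self
  · have d1 : ‖x‖ₑ ≤ 2 * ‖y‖ₑ := (not_le.1 c1).le
    have d2 : ‖y‖ₑ ≤ 2 * ‖x‖ₑ := (not_le.1 c2).le
    have hK : swK (b + c) a x y = ‖x‖ₑ ^ (-(b + c)) * ‖x - y‖ₑ ^ (-a) := by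
      unfold swK
      rw [if_pos ⟨d2, d1⟩]
    have h1 : ‖y‖ₑ ^ (-b) ≤ 2 ^ |b| * ‖x‖ₑ ^ (-b) := by
      rcases le_total 0 b with hb | hb
      · rw [abs_of_nonneg hb]
        exact sw_cmp ‖x‖ₑ ‖y‖ₑ 2 b hb enorm_ne_top (by norm_num) (by norm_num) d1
      · rw [abs_of_nonpos hb, ← ENNReal.mul_rpow_of_nonneg _ _ (by linarith)]
        exact ENNReal.rpow_le_rpow d2 (by linarith)
    rw [hK]
    calc ‖x‖ₑ ^ (-c) * ‖x - y‖ₑ ^ (-a) * ‖y‖ₑ ^ (-b)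
        ≤ ‖x‖ₑ ^ (-c) * ‖x - y‖ₑ ^ (-a) * (2 ^ (a + |b|) * ‖x‖ₑ ^ (-b)) := by
          gcongr
          exact h1.trans (by gcongr)
      _ = 2 ^ (a + |b|) * (‖x‖ₑ ^ (-(b + c)) * ‖x - y‖ₑ ^ (-a)) := by
          rw [show -(b + c) = -b + -c by ring, ← sw_rpow_add x hx]; ring
      _ ≤ _ := by
          gcongr
          exact le_add_self

lemma sw_add3 (u v w : ℝ≥0∞) (r : ℝ) (hr : 0 ≤ r) :
    (u + v + w) ^ r ≤ 3 ^ r * (u ^ r + v ^ r + w ^ r) := by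
  have h1 : u + v + w ≤ 3 * max u (max v w) := by
    calc u + v + w ≤ max u (max v w) + max u (max v w) + max u (max v w) := by
          gcongr <;> simp
      _ = _ := by ring
  calc (u + v + w) ^ r ≤ (3 * max u (max v w)) ^ r := by gcongr
    _ = 3 ^ r * (max u (max v w)) ^ r := ENNReal.mul_rpow_of_nonneg _ _ hr
    _ ≤ _ := by
      gcongr
      rcases max_choice u (max v w) with h | h
      · rw [h, add_assoc]; exact le_self_add
      · rw [h]
        rcases max_choice v w with h | h
        · rw [h, add_right_comm]; exact le_add_self
        · rw [h]; exact le_add_self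


lemma sw_main0 (D q q' r a b c : ℝ) (hD : (Module.finrank ℝ E : ℝ) = D)
    (hq : q.HolderConjugate q') (hqr : q ≤ r) (hs : a + b + c = D / q' + D / r)
    (hbc : 0 ≤ b + c) (ha : 0 < a) (haD : a < D) (hb : b * q' < D) (hc : D < (a + b) * q') :
    ∃ C : ℝ≥0∞, C ≠ ⊤ ∧ ∀ h : E → ℝ≥0∞, Measurable h → ∫⁻ y, h y ^ q ≤ 1 →
      ∫⁻ x : E, (∫⁻ y, (‖x‖ₑ ^ (-c) * ‖x - y‖ₑ ^ (-a) * ‖y‖ₑ ^ (-b)) * h y) ^ r ≤ C := by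
  have hr : 0 ≤ r := hq.pos.le.trans hqr
  obtain ⟨C1, hC1, H1⟩ := sw_r1 (E := E) D q q' r (a + c) b hD hq hqr (by linarith) hb
  obtain ⟨C2, hC2, H2⟩ := sw_r2 (E := E) D q q' r c (a + b) hD hq hqr (by linarith) hc
  obtain ⟨C3, hC3, H3⟩ := sw_r3 (E := E) D q q' r a (b + c) hD hq hqr haD hbc (by linarith)
  set M : ℝ≥0∞ := 2 ^ (a + |b|) with hM
  have hMt : M ≠ ⊤ := ENNReal.rpow_ne_top_of_nonneg (by positivity) (by simp)
  refine ⟨(M ^ r * 3 ^ r) * (C1 + C2 + C3), ?_, ?_⟩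
  · refine ENNReal.mul_ne_top (ENNReal.mul_ne_top ?_ ?_) (by simp [hC1, hC2, hC3])
    · exact ENNReal.rpow_ne_top_of_nonneg hr hMt
    · exact ENNReal.rpow_ne_top_of_nonneg hr (by simp)
  intro h hh hn
  set K1 : E → E → ℝ≥0∞ := fun x y =>
    (if ‖y‖ₑ ≤ ‖x‖ₑ then 1 else 0) * ‖x‖ₑ ^ (-(a + c)) * ‖y‖ₑ ^ (-b) with hK1
  set K2 : E → E → ℝ≥0∞ := fun x y =>
    (if ‖x‖ₑ ≤ ‖y‖ₑ then 1 else 0) * ‖x‖ₑ ^ (-c) * ‖y‖ₑ ^ (-(a + b)) with hK2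
  have s1 : MeasurableSet {p : E × E | ‖p.2‖ₑ ≤ ‖p.1‖ₑ} :=
    measurableSet_le (by fun_prop) (by fun_prop)
  have s2 : MeasurableSet {p : E × E | ‖p.1‖ₑ ≤ ‖p.2‖ₑ} :=
    measurableSet_le (by fun_prop) (by fun_prop)
  have m1 : Measurable (fun p : E × E => K1 p.1 p.2 * h p.2) := by
    simp only [hK1]
    refine Measurable.mul (Measurable.mul (Measurable.mul ?_ (by fun_prop)) (by fun_prop))
      (by fun_prop)
    exact Measurable.ite s1 (by fun_prop) (by fun_prop)
  have m2 : Measurable (fun p : E × E => K2 p.1 p.2 * h p.2) := by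
    simp only [hK2]
    refine Measurable.mul (Measurable.mul (Measurable.mul ?_ (by fun_prop)) (by fun_prop))
      (by fun_prop)
    exact Measurable.ite s2 (by fun_prop) (by fun_prop)
  have m3 : Measurable (fun p : E × E => swK (b + c) a p.1 p.2 * h p.2) :=
    Measurable.mul (swK_meas (b + c) a) (by fun_prop)
  have n1 : Measurable (fun x : E => ∫⁻ y, K1 x y * h y) := m1.lintegral_prod_right'
  have n2 : Measurable (fun x : E => ∫⁻ y, K2 x y * h y) := m2.lintegral_prod_right'
  have n3 : Measurable (fun x : E => ∫⁻ y, swK (b + c) a x y * h y) := m3.lintegral_prod_right'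
  have e1 : ∫⁻ x : E, (∫⁻ y, K1 x y * h y) ^ r ≤ C1 := H1 h hh hn
  have e2 : ∫⁻ x : E, (∫⁻ y, K2 x y * h y) ^ r ≤ C2 := H2 h hh hn
  have e3 : ∫⁻ x : E, (∫⁻ y, swK (b + c) a x y * h y) ^ r ≤ C3 := H3 h hh hn
  have hpt : ∀ x y : E, x ≠ 0 → y ≠ 0 → ‖x‖ₑ ^ (-c) * ‖x - y‖ₑ ^ (-a) * ‖y‖ₑ ^ (-b)
      ≤ M * (K1 x y + K2 x y + swK (b + c) a x y) :=
    fun x y hx hy => sw_pointwise a b c ha x y hx hy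
  clear_value K1 K2 M
  calc ∫⁻ x : E, (∫⁻ y, (‖x‖ₑ ^ (-c) * ‖x - y‖ₑ ^ (-a) * ‖y‖ₑ ^ (-b)) * h y) ^ r
      ≤ ∫⁻ x : E, (M ^ r * 3 ^ r) * ((∫⁻ y, K1 x y * h y) ^ r + (∫⁻ y, K2 x y * h y) ^ r
          + (∫⁻ y, swK (b + c) a x y * h y) ^ r) := by
        refine lintegral_mono_ae ?_
        filter_upwards [sw_ae_ne (0 : E)] with x hx
        have p1 : ∫⁻ y, (‖x‖ₑ ^ (-c) * ‖x - y‖ₑ ^ (-a) * ‖y‖ₑ ^ (-b)) * h y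
            ≤ M * ((∫⁻ y, K1 x y * h y) + (∫⁻ y, K2 x y * h y)
              + ∫⁻ y, swK (b + c) a x y * h y) := by
          have k1 : Measurable (fun y => K1 x y * h y) := by
            exact m1.comp (measurable_prodMk_left (x := x))
          have k3 : Measurable (fun y => swK (b + c) a x y * h y) := by
            exact m3.comp (measurable_prodMk_left (x := x))
          rw [← lintegral_add_left k1, ← lintegral_add_right _ k3,
            ← lintegral_const_mul' _ _ hMt]
          refine lintegral_mono_ae ?_
          filter_upwards [sw_ae_ne (0 : E)] with y hy
          calc _ ≤ (M * (K1 x y + K2 x y + swK (b + c) a x y)) * h y :=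
                mul_le_mul_left (hpt x y hx hy) _
            _ = _ := by ring
        calc _ ≤ (M * ((∫⁻ y, K1 x y * h y) + (∫⁻ y, K2 x y * h y)
              + ∫⁻ y, swK (b + c) a x y * h y)) ^ r := ENNReal.rpow_le_rpow p1 hr
          _ = M ^ r * _ := ENNReal.mul_rpow_of_nonneg _ _ hr
          _ ≤ M ^ r * _ := mul_le_mul_right (sw_add3 _ _ _ r hr) _
          _ = _ := by rw [mul_assoc]
    _ = (M ^ r * 3 ^ r) * ((∫⁻ x : E, (∫⁻ y, K1 x y * h y) ^ r)
          + (∫⁻ x : E, (∫⁻ y, K2 x y * h y) ^ r)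
          + ∫⁻ x : E, (∫⁻ y, swK (b + c) a x y * h y) ^ r) := by
        rw [lintegral_const_mul _ (by fun_prop), lintegral_add_right _ (by fun_prop),
          lintegral_add_right _ (by fun_prop)]
    _ ≤ _ := by gcongr

lemma sw_main (D q q' r a b c : ℝ) (hD : (Module.finrank ℝ E : ℝ) = D)
    (hq : q.HolderConjugate q') (hqr : q ≤ r) (hs : a + b + c = D / q' + D / r)
    (hbc : 0 ≤ b + c) (ha : 0 < a) (haD : a < D) (hb : b * q' < D) (hc : D < (a + b) * q') :
    ∃ C : ℝ≥0∞, C ≠ ⊤ ∧ ∀ h : E → ℝ≥0∞, Measurable h →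
      (∫⁻ x : E, (∫⁻ y, (‖x‖ₑ ^ (-c) * ‖x - y‖ₑ ^ (-a) * ‖y‖ₑ ^ (-b)) * h y) ^ r) ^ (1 / r)
        ≤ C * (∫⁻ y, h y ^ q) ^ (1 / q) := by
  have hq0 : 0 < q := hq.pos
  have hr : 0 < r := hq0.trans_le hqr
  obtain ⟨C0, hC0, H⟩ := sw_main0 (E := E) D q q' r a b c hD hq hqr hs hbc ha haD hb hc
  refine ⟨C0 ^ (1 / r) + 1, ?_, ?_⟩
  · simp only [ne_eq, ENNReal.add_eq_top, ENNReal.one_ne_top, or_false]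
    exact ENNReal.rpow_ne_top_of_nonneg (by positivity) hC0
  intro h hh
  set N := (∫⁻ y, h y ^ q) ^ (1 / q) with hN
  have hNq : N ^ q = ∫⁻ y, h y ^ q := by
    rw [hN, ← ENNReal.rpow_mul, one_div, inv_mul_cancel₀ hq0.ne', ENNReal.rpow_one]
  by_cases hNt : N = ⊤
  · rw [hNt, ENNReal.mul_top (by simp)]
    exact le_top
  by_cases hN0 : N = 0
  · rw [hN0, ENNReal.zero_rpow_of_pos hq0, eq_comm, lintegral_eq_zero_iff (by fun_prop)] at hNq
    have hz : ∀ᵐ y, h y = 0 := by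
      filter_upwards [hNq] with y hy
      simpa [ENNReal.rpow_eq_zero_iff, hq0, hq0.not_gt] using hy
    have : ∀ x : E, ∫⁻ y, (‖x‖ₑ ^ (-c) * ‖x - y‖ₑ ^ (-a) * ‖y‖ₑ ^ (-b)) * h y = 0 := by
      intro x
      rw [← lintegral_zero (μ := (volume : Measure E))]
      refine lintegral_congr_ae ?_
      filter_upwards [hz] with y hy
      simp [hy]
    simp [this, hr]
  have h1 := H (fun y => N⁻¹ * h y) (by fun_prop) (by
    simp only [ENNReal.mul_rpow_of_nonneg _ _ hq0.le]
    rw [lintegral_const_mul _ (by fun_prop), ← hNq, ENNReal.inv_rpow]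
    exact (ENNReal.inv_mul_cancel (by simp [hN0, hNt, hq0]) (by simp [hN0, hNt, hq0])).le)
  have h2 : ∀ x : E, ∫⁻ y, (‖x‖ₑ ^ (-c) * ‖x - y‖ₑ ^ (-a) * ‖y‖ₑ ^ (-b)) * h y
      = N * ∫⁻ y, (‖x‖ₑ ^ (-c) * ‖x - y‖ₑ ^ (-a) * ‖y‖ₑ ^ (-b)) * (N⁻¹ * h y) := by
    intro x
    rw [← lintegral_const_mul' _ _ hNt]
    refine lintegral_congr fun y => ?_
    have := ENNReal.mul_inv_cancel hN0 hNt
    calc _ = (N * N⁻¹) * ((‖x‖ₑ ^ (-c) * ‖x - y‖ₑ ^ (-a) * ‖y‖ₑ ^ (-b)) * h y) := by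
          rw [this, one_mul]
      _ = _ := by ring
  simp only [h2, ENNReal.mul_rpow_of_nonneg _ _ hr.le]
  rw [lintegral_const_mul' _ _ (ENNReal.rpow_ne_top_of_nonneg hr.le hNt),
    ENNReal.mul_rpow_of_nonneg _ _ (by positivity), ← ENNReal.rpow_mul, mul_one_div_cancel hr.ne',
    ENNReal.rpow_one, mul_comm]
  refine mul_le_mul_left ?_ _
  exact (ENNReal.rpow_le_rpow h1 (by positivity)).trans le_self_add
end SW

/-- Weighted Young inequality of Stein--Weiss type:
`‖ |x|^{-c} (f*g) ‖_{L^r} ≤ C ‖ |x|^a f ‖_{L^∞} ‖ |x|^b g ‖_{L^q}` under the stated conditions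
on the parameters. -/
theorem weighted_young_stein_weiss (d : ℕ) (hd : 1 ≤ d) (q r a b c : ℝ)
    (hq : 1 < q) (hqr : q ≤ r)
    (h1 : 1 / r = 1 / q - 1 + (a + b + c) / d)
    (h2 : 0 ≤ b + c) (h3 : 0 < a) (h4 : a < d)
    (h5 : b < d * (1 - 1 / q)) (h6 : c < d / r) :
    ∃ C : ℝ≥0, ∀ f g : EuclideanSpace ℝ (Fin d) → ℝ, Measurable f → Measurable g →
      (∫⁻ x, ((∫⁻ y, ENNReal.ofReal |f (x - y)| * ENNReal.ofReal |g y|) *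
          ENNReal.ofReal (‖x‖ ^ (-c))) ^ r) ^ (1 / r) ≤
        C * essSup (fun x : EuclideanSpace ℝ (Fin d) => ENNReal.ofReal (|f x| * ‖x‖ ^ a)) volume *
          (∫⁻ x, ENNReal.ofReal (|g x| * ‖x‖ ^ b) ^ q) ^ (1 / q) := by
  have hdpos : (0 : ℝ) < d := by exact_mod_cast hd
  have hr : 0 < r := by linarith
  have : Nonempty (Fin d) := ⟨⟨0, hd⟩⟩
  have hconj := Real.HolderConjugate.conjExponent hq
  set q' := q.conjExponent with hq'
  have hq0' : 0 < q' := hconj.symm.pos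
  have hinv : 1 / q + 1 / q' = 1 := by simpa [one_div] using hconj.inv_add_inv_eq_one
  have hq1 : 1 - 1 / q = 1 / q' := by linarith
  have hs : a + b + c = d / q' + d / r := by
    have : (a + b + c) / d = 1 / q' + 1 / r := by linarith
    rw [div_eq_iff hdpos.ne'] at this
    rw [this]; ring
  have hb : b * q' < d := by
    rw [hq1, mul_one_div, lt_div_iff₀ hq0'] at h5
    exact h5
  have hc : d < (a + b) * q' := by
    rw [← div_lt_iff₀ hq0']
    linarith
  obtain ⟨C, hCt, H⟩ := sw_main (E := EuclideanSpace ℝ (Fin d)) d q q' r a b c (by simp) hconj hqr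
    hs h2 h3 h4 hb hc
  refine ⟨C.toNNReal, ?_⟩
  intro f g hf hg
  rw [ENNReal.coe_toNNReal hCt]
  set M := essSup (fun x : EuclideanSpace ℝ (Fin d) => ENNReal.ofReal (|f x| * ‖x‖ ^ a)) volume
    with hM
  set h : EuclideanSpace ℝ (Fin d) → ℝ≥0∞ := fun y => ENNReal.ofReal (|g y| * ‖y‖ ^ b) with hh
  have hhm : Measurable h := by
    have : Measurable (fun y => |g y|) := measurable_norm.comp hg
    fun_prop
  have hfM : ∀ᵐ z : EuclideanSpace ℝ (Fin d), ENNReal.ofReal |f z| ≤ M * ‖z‖ₑ ^ (-a) := by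
    filter_upwards [sw_ae_ne (0 : EuclideanSpace ℝ (Fin d)), ENNReal.ae_le_essSup
      (fun x : EuclideanSpace ℝ (Fin d) => ENNReal.ofReal (|f x| * ‖x‖ ^ a))] with z hz hle
    rw [ENNReal.ofReal_mul (abs_nonneg _), ← sw_enorm_rpow z hz] at hle
    calc ENNReal.ofReal |f z| = (ENNReal.ofReal |f z| * ‖z‖ₑ ^ a) * ‖z‖ₑ ^ (-a) := by
          rw [mul_assoc, sw_rpow_add z hz]; simp
      _ ≤ _ := mul_le_mul_left hle _
  have hgh : ∀ y : EuclideanSpace ℝ (Fin d), y ≠ 0 →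
      ENNReal.ofReal |g y| = ‖y‖ₑ ^ (-b) * h y := by
    intro y hy
    simp only [hh]
    rw [ENNReal.ofReal_mul (abs_nonneg _), ← sw_enorm_rpow y hy, mul_left_comm, sw_rpow_add y hy]
    simp
  set T : EuclideanSpace ℝ (Fin d) → ℝ≥0∞ := fun x =>
    ∫⁻ y, (‖x‖ₑ ^ (-c) * ‖x - y‖ₑ ^ (-a) * ‖y‖ₑ ^ (-b)) * h y with hT
  have hTm : Measurable T := by
    have : Measurable (fun p : EuclideanSpace ℝ (Fin d) × EuclideanSpace ℝ (Fin d) =>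
      (‖p.1‖ₑ ^ (-c) * ‖p.1 - p.2‖ₑ ^ (-a) * ‖p.2‖ₑ ^ (-b)) * h p.2) := by fun_prop
    exact this.lintegral_prod_right'
  have key : ∫⁻ x, ((∫⁻ y, ENNReal.ofReal |f (x - y)| * ENNReal.ofReal |g y|) *
      ENNReal.ofReal (‖x‖ ^ (-c))) ^ r ≤ ∫⁻ x, (M * T x) ^ r := by
    refine lintegral_mono_ae ?_
    filter_upwards [sw_ae_ne (0 : EuclideanSpace ℝ (Fin d))] with x hx
    refine ENNReal.rpow_le_rpow ?_ hr.le
    rw [← sw_enorm_rpow x hx, hT]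
    simp only
    rw [← lintegral_mul_const' _ _ (sw_rpow_neg_ne_top x hx _),
      ← lintegral_const_mul _ (by fun_prop)]
    refine lintegral_mono_ae ?_
    have hq := (quasiMeasurePreserving_sub_left_of_right_invariant
      (volume : Measure (EuclideanSpace ℝ (Fin d))) x).ae hfM
    filter_upwards [hq, sw_ae_ne (0 : EuclideanSpace ℝ (Fin d))] with y h1 hy
    rw [hgh y hy]
    calc _ ≤ (M * ‖x - y‖ₑ ^ (-a)) * (‖y‖ₑ ^ (-b) * h y) * ‖x‖ₑ ^ (-c) := by gcongr
      _ = _ := by ring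
  calc _ ≤ (∫⁻ x, (M * T x) ^ r) ^ (1 / r) := ENNReal.rpow_le_rpow key (by positivity)
    _ = M * (∫⁻ x, T x ^ r) ^ (1 / r) := by
      simp only [ENNReal.mul_rpow_of_nonneg _ _ hr.le]
      rw [lintegral_const_mul _ (by fun_prop), ENNReal.mul_rpow_of_nonneg _ _ (by positivity),
        ← ENNReal.rpow_mul, mul_one_div_cancel hr.ne', ENNReal.rpow_one]
    _ ≤ M * (C * (∫⁻ y, h y ^ q) ^ (1 / q)) := mul_le_mul_right (H h hhm) _
    _ = _ := by ring
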